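/- arXiv:math/0611122 — 4 statements merged into one kernel-verified Lean document; each statement's English description precedes it below -/
import Mathlib

section
/- In ℂ[t, x_1, …, x_7] the following identity holds: 3·z_2² + z_4 = t²·(x_4·t − 4·x_1·x_3 + 3·x_2²), and moreover D1(x_4·t − 4·x_1·x_3 + 3·x_2²) = 0. (The polynomial dv_1 = x_4 t − 4 x_1 x_3 + 3 x_2² is the semi-invariant [t,t]^4 of degree 2.) -/
open MvPolynomial Finset

/-- The derivation `D1 = t·∂/∂x₁ + 2x₁·∂/∂x₂ + ⋯ + 7x₆·∂/∂x₇` on `ℂ[t, x₁, …, x₇]`,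
where the variable of index `0` is `t` and the variable of index `j ≥ 1` is `x_j`. -/
noncomputable def D1 : Derivation ℂ (MvPolynomial (Fin 8) ℂ) (MvPolynomial (Fin 8) ℂ) :=
  MvPolynomial.mkDerivation ℂ
    ![0, MvPolynomial.X 0, 2 * MvPolynomial.X 1, 3 * MvPolynomial.X 2, 4 * MvPolynomial.X 3,
      5 * MvPolynomial.X 4, 6 * MvPolynomial.X 5, 7 * MvPolynomial.X 6]

/-- The derivation `D2 = 7x₁·∂/∂t + 6x₂·∂/∂x₁ + ⋯ + x₇·∂/∂x₆` on `ℂ[t, x₁, …, x₇]`. -/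
noncomputable def D2 : Derivation ℂ (MvPolynomial (Fin 8) ℂ) (MvPolynomial (Fin 8) ℂ) :=
  MvPolynomial.mkDerivation ℂ
    ![7 * MvPolynomial.X 1, 6 * MvPolynomial.X 2, 5 * MvPolynomial.X 3, 4 * MvPolynomial.X 4,
      3 * MvPolynomial.X 5, 2 * MvPolynomial.X 6, MvPolynomial.X 7, 0]

/-- `t = X 0`. -/
noncomputable def t : MvPolynomial (Fin 8) ℂ := MvPolynomial.X 0
/-- `x_j = X j` for `1 ≤ j ≤ 7`. -/
noncomputable def x (j : Fin 8) : MvPolynomial (Fin 8) ℂ := MvPolynomial.X j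

/-- `z₂ = x₂t − x₁²`. -/
noncomputable def z2 : MvPolynomial (Fin 8) ℂ := x 2 * t - x 1 ^ 2
/-- `z₃ = x₃t² + 2x₁³ − 3x₁x₂t`. -/
noncomputable def z3 : MvPolynomial (Fin 8) ℂ := x 3 * t ^ 2 + 2 * x 1 ^ 3 - 3 * x 1 * x 2 * t
/-- `z₄ = x₄t³ − 3x₁⁴ + 6x₁²x₂t − 4x₁x₃t²`. -/
noncomputable def z4 : MvPolynomial (Fin 8) ℂ :=
  x 4 * t ^ 3 - 3 * x 1 ^ 4 + 6 * x 1 ^ 2 * x 2 * t - 4 * x 1 * x 3 * t ^ 2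
/-- `z₅ = x₅t⁴ + 4x₁⁵ − 10x₁³x₂t + 10x₁²x₃t² − 5x₁x₄t³`. -/
noncomputable def z5 : MvPolynomial (Fin 8) ℂ :=
  x 5 * t ^ 4 + 4 * x 1 ^ 5 - 10 * x 1 ^ 3 * x 2 * t + 10 * x 1 ^ 2 * x 3 * t ^ 2 -
    5 * x 1 * x 4 * t ^ 3
/-- `z₆ = x₆t⁵ − 5x₁⁶ + 15x₁⁴x₂t − 20x₁³x₃t² + 15x₁²x₄t³ − 6x₁x₅t⁴`. -/
noncomputable def z6 : MvPolynomial (Fin 8) ℂ :=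
  x 6 * t ^ 5 - 5 * x 1 ^ 6 + 15 * x 1 ^ 4 * x 2 * t - 20 * x 1 ^ 3 * x 3 * t ^ 2 +
    15 * x 1 ^ 2 * x 4 * t ^ 3 - 6 * x 1 * x 5 * t ^ 4
/-- `z₇ = x₇t⁶ + 6x₁⁷ − 21x₁⁵x₂t + 35x₁⁴x₃t² − 35x₁³x₄t³ + 21x₁²x₅t⁴ − 7x₁x₆t⁵`. -/
noncomputable def z7 : MvPolynomial (Fin 8) ℂ :=
  x 7 * t ^ 6 + 6 * x 1 ^ 7 - 21 * x 1 ^ 5 * x 2 * t + 35 * x 1 ^ 4 * x 3 * t ^ 2 -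
    35 * x 1 ^ 3 * x 4 * t ^ 3 + 21 * x 1 ^ 2 * x 5 * t ^ 4 - 7 * x 1 * x 6 * t ^ 5

/-- `3z₂² + z₄ = t²·(x₄t − 4x₁x₃ + 3x₂²)` and `dv₁ = x₄t − 4x₁x₃ + 3x₂²` is a
semi-invariant: `D1(dv₁) = 0`. -/
theorem dv1_identity :
    3 * z2 ^ 2 + z4 = t ^ 2 * (x 4 * t - 4 * x 1 * x 3 + 3 * x 2 ^ 2) ∧
      D1 (x 4 * t - 4 * x 1 * x 3 + 3 * x 2 ^ 2) = 0 := by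
  have h0 : D1 t = 0 := by simp [D1, t, mkDerivation_X]
  have h1 : D1 (x 1) = t := by simp [D1, t, x, mkDerivation_X]
  have h2 : D1 (x 2) = 2 * x 1 := by simp [D1, x, mkDerivation_X]
  have h3 : D1 (x 3) = 3 * x 2 := by simp [D1, x, mkDerivation_X]
  have h4 : D1 (x 4) = 4 * x 3 := by simp [D1, x, mkDerivation_X]
  have n3 : D1 3 = 0 := by exact_mod_cast D1.map_natCast 3
  have n4 : D1 4 = 0 := by exact_mod_cast D1.map_natCast 4
  constructor
  · simp only [z2, z4]
    ring
  · rw [pow_two]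
    simp only [map_add, map_sub, Derivation.leibniz, smul_eq_mul, h0, h1, h2, h3, h4, n3, n4]
    ring
end

section
/- In ℂ[t, x_1, …, x_7] the following identity holds: z_6 + 15·z_2·z_4 − 10·z_3² = t⁴·(x_6·t − 6·x_1·x_5 + 15·x_2·x_4 − 10·x_3²), and moreover D1(x_6·t − 6·x_1·x_5 + 15·x_2·x_4 − 10·x_3²) = 0. (The polynomial dv_2 = x_6 t − 6 x_1 x_5 + 15 x_2 x_4 − 10 x_3² is the semi-invariant [t,t]^6 of degree 2.) -/
open MvPolynomial Finset

/-- `z₆ + 15z₂z₄ − 10z₃² = t⁴·(x₆t − 6x₁x₅ + 15x₂x₄ − 10x₃²)` and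
`dv₂ = x₆t − 6x₁x₅ + 15x₂x₄ − 10x₃²` is a semi-invariant: `D1(dv₂) = 0`. -/
theorem dv2_identity :
    z6 + 15 * z2 * z4 - 10 * z3 ^ 2 =
        t ^ 4 * (x 6 * t - 6 * x 1 * x 5 + 15 * x 2 * x 4 - 10 * x 3 ^ 2) ∧
      D1 (x 6 * t - 6 * x 1 * x 5 + 15 * x 2 * x 4 - 10 * x 3 ^ 2) = 0 := by
  have h0 : D1 t = 0 := by simp [D1, t, mkDerivation_X]
  have h1 : D1 (x 1) = t := by simp [D1, x, t, mkDerivation_X]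
  have h2 : D1 (x 2) = 2 * x 1 := by simp [D1, x, mkDerivation_X]
  have h3 : D1 (x 3) = 3 * x 2 := by simp [D1, x, mkDerivation_X]
  have h4 : D1 (x 4) = 4 * x 3 := by simp [D1, x, mkDerivation_X]
  have h5 : D1 (x 5) = 5 * x 4 := by simp [D1, x, mkDerivation_X]
  have h6 : D1 (x 6) = 6 * x 5 := by simp [D1, x, mkDerivation_X]
  have n6 : D1 6 = 0 := D1.map_natCast 6
  have n15 : D1 15 = 0 := D1.map_natCast 15
  have n10 : D1 10 = 0 := D1.map_natCast 10
  constructor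
  · unfold z6 z2 z4 z3
    ring
  · simp only [map_add, map_sub, Derivation.leibniz, pow_two, smul_eq_mul,
      h0, h1, h2, h3, h4, h5, h6, n6, n15, n10]
    ring
end

section
/- In ℂ[t, x_1, …, x_7] the action of the derivation D2 on the semi-invariants z_2, …, z_7 is given by the six identities: t·D2(z_2) = 5·(2 x_1 z_2 + z_3); t·D2(z_3) = 15 x_1 z_3 − 18 z_2² + 4 z_4; t·D2(z_4) = 20 x_1 z_4 − 24 z_2 z_3 + 3 z_5; t·D2(z_5) = 2 z_6 + 25 x_1 z_5 − 30 z_2 z_4; t·D2(z_6) = z_7 + 30 x_1 z_6 − 36 z_2 z_5; t·D2(z_7) = 7·(5 x_1 z_7 − 6 z_2 z_6). -/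
open MvPolynomial Finset

theorem D2_t_aux : D2 t = 7 * x 1 := by simp [D2, t, x, mkDerivation_X]
theorem D2_x1_aux : D2 (x 1) = 6 * x 2 := by simp [D2, x, mkDerivation_X]
theorem D2_x2_aux : D2 (x 2) = 5 * x 3 := by simp [D2, x, mkDerivation_X]
theorem D2_x3_aux : D2 (x 3) = 4 * x 4 := by simp [D2, x, mkDerivation_X]
theorem D2_x4_aux : D2 (x 4) = 3 * x 5 := by simp [D2, x, mkDerivation_X]
theorem D2_x5_aux : D2 (x 5) = 2 * x 6 := by simp [D2, x, mkDerivation_X]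
theorem D2_x6_aux : D2 (x 6) = x 7 := by simp [D2, x, mkDerivation_X]
theorem D2_x7_aux : D2 (x 7) = 0 := by simp [D2, x, mkDerivation_X]
theorem D2_num_aux (n : ℕ) (p : MvPolynomial (Fin 8) ℂ) (h : (n : MvPolynomial (Fin 8) ℂ) = p) :
    D2 p = 0 := by
  rw [← h]
  exact D2.map_natCast _

/-- Action of the derivation `D2` on the semi-invariants `z₂, …, z₇` of the binary
septimic, expressed by six polynomial identities. -/
theorem D2_action_on_z :
    t * D2 z2 = 5 * (2 * x 1 * z2 + z3) ∧
    t * D2 z3 = 15 * x 1 * z3 - 18 * z2 ^ 2 + 4 * z4 ∧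
    t * D2 z4 = 20 * x 1 * z4 - 24 * z2 * z3 + 3 * z5 ∧
    t * D2 z5 = 2 * z6 + 25 * x 1 * z5 - 30 * z2 * z4 ∧
    t * D2 z6 = z7 + 30 * x 1 * z6 - 36 * z2 * z5 ∧
    t * D2 z7 = 7 * (5 * x 1 * z7 - 6 * z2 * z6) := by
  have h2 : D2 2 = 0 := D2_num_aux 2 _ (by norm_num)
  have h3 : D2 3 = 0 := D2_num_aux 3 _ (by norm_num)
  have h4 : D2 4 = 0 := D2_num_aux 4 _ (by norm_num)
  have h5 : D2 5 = 0 := D2_num_aux 5 _ (by norm_num)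
  have h6 : D2 6 = 0 := D2_num_aux 6 _ (by norm_num)
  have h7 : D2 7 = 0 := D2_num_aux 7 _ (by norm_num)
  have h10 : D2 10 = 0 := D2_num_aux 10 _ (by norm_num)
  have h15 : D2 15 = 0 := D2_num_aux 15 _ (by norm_num)
  have h20 : D2 20 = 0 := D2_num_aux 20 _ (by norm_num)
  have h21 : D2 21 = 0 := D2_num_aux 21 _ (by norm_num)
  have h35 : D2 35 = 0 := D2_num_aux 35 _ (by norm_num)
  refine ⟨?_, ?_, ?_, ?_, ?_, ?_⟩ <;>
  · simp only [z2, z3, z4, z5, z6, z7, map_add, map_sub, Derivation.leibniz,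
      Derivation.leibniz_pow, smul_eq_mul, nsmul_eq_mul, h2, h3, h4, h5, h6, h7, h10, h15, h20, h21, h35,
      D2_t_aux, D2_x1_aux,
      D2_x2_aux, D2_x3_aux, D2_x4_aux, D2_x5_aux, D2_x6_aux, D2_x7_aux]
    push_cast
    ring
end

section
/- (Main theorem: complete system of invariants of the binary septimic.) There exist 30 polynomials p_1, …, p_30 in ℂ[t, x_1, …, x_7], each homogeneous and satisfying D1(p_j) = 0 and D2(p_j) = 0, whose degrees are: one of degree 4; three of degree 8; six of degree 12; four of degree 14; two of degree 16; nine of degree 18; one of degree 20; two of degree 22; one of degree 26; and one of degree 30; such that every f ∈ ℂ[t, x_1, …, x_7] with D1(f) = 0 and D2(f) = 0 lies in the ℂ-subalgebra generated by p_1, …, p_30. -/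
open MvPolynomial Finset

/-- The multiset of degrees of the 30 generating invariants: one of degree 4, three
of degree 8, six of degree 12, four of degree 14, two of degree 16, nine of degree 18,
one of degree 20, two of degree 22, one of degree 26 and one of degree 30. -/
def degs : Fin 30 → ℕ :=
  ![4, 8, 8, 8, 12, 12, 12, 12, 12, 12, 14, 14, 14, 14, 16, 16, 18, 18, 18, 18, 18, 18, 18,
    18, 18, 20, 22, 22, 26, 30]


namespace Sept

noncomputable def Dg (c : Fin 8 → ℂ) : Derivation ℂ (MvPolynomial (Fin 8) ℂ) (MvPolynomial (Fin 8) ℂ) :=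
  MvPolynomial.mkDerivation ℂ (fun i => c i • MvPolynomial.X i)

noncomputable def HH := Dg (fun i => 7 - 2 * ((i : ℕ) : ℂ))
noncomputable def NN := Dg (fun _ => 1)

theorem coeff_Dg (c : Fin 8 → ℂ) (p : MvPolynomial (Fin 8) ℂ) (l : Fin 8 →₀ ℕ) :
    coeff l (Dg c p) = (∑ i, c i * (l i : ℂ)) * coeff l p := by
  induction p using MvPolynomial.induction_on' with
  | add p q hp hq => simp [hp, hq, mul_add]
  | monomial u a =>
    have h1 : Dg c (monomial u a) = (∑ i, c i * (u i : ℂ)) • monomial u a := by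
      rw [Dg, mkDerivation_monomial, Finsupp.sum_fintype _ _ (by simp), Finset.smul_sum, Finset.sum_smul]
      refine Finset.sum_congr rfl fun i _ => ?_
      by_cases hi : u i = 0
      · simp [hi]
      · have : u - Finsupp.single i 1 + Finsupp.single i 1 = u := by
          apply tsub_add_cancel_of_le
          simp; omega
        simp only [smul_eq_mul, X, monomial_mul, this, smul_monomial]
        congr 1; ring
    rw [h1, coeff_smul, coeff_monomial]
    split_ifs with h
    · subst h; simp
    · simp

theorem lieD : ∀ p, D1 (D2 p) = D2 (D1 p) + HH p := by
  intro p
  have : ⁅D1, D2⁆ = HH := by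
    apply MvPolynomial.derivation_ext
    intro i
    rw [Derivation.commutator_apply]
    fin_cases i <;>
    simp [D1, D2, HH, Dg, mkDerivation_X, Derivation.leibniz, smul_eq_C_mul] <;> ring_nf
    all_goals simp [← map_ofNat C, derivation_C]
    all_goals (simp only [map_ofNat]; ring)
  have h2 := congrArg (fun D => D p) this
  simp only [Derivation.commutator_apply] at h2
  rw [← h2]; ring

theorem lieHD1 : ∀ p, HH (D1 p) = D1 (HH p) + 2 * D1 p := by
  intro p
  have : ⁅HH, D1⁆ = (2 : ℂ) • D1 := by
    apply MvPolynomial.derivation_ext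
    intro i
    rw [Derivation.commutator_apply]
    fin_cases i <;>
    simp [D1, HH, Dg, mkDerivation_X, Derivation.leibniz, smul_eq_C_mul] <;> ring_nf
    all_goals simp [← map_ofNat C, derivation_C]
  have h2 := congrArg (fun D => D p) this
  simp only [Derivation.commutator_apply, Derivation.smul_apply, smul_eq_C_mul, map_ofNat] at h2
  rw [← h2]; ring

theorem lieHD2 : ∀ p, HH (D2 p) = D2 (HH p) - 2 * D2 p := by
  intro p
  have : ⁅HH, D2⁆ = (-2 : ℂ) • D2 := by
    apply MvPolynomial.derivation_ext
    intro i
    rw [Derivation.commutator_apply]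
    fin_cases i <;>
    simp [D2, HH, Dg, mkDerivation_X, Derivation.leibniz, smul_eq_C_mul] <;> ring_nf
    all_goals simp [← map_ofNat C, derivation_C]
  have h2 := congrArg (fun D => D p) this
  simp only [Derivation.commutator_apply, Derivation.smul_apply, smul_eq_C_mul, map_neg, map_ofNat] at h2
  rw [sub_eq_add_neg, ← neg_mul, ← h2]; ring

theorem lieND1 : ∀ p, NN (D1 p) = D1 (NN p) := by
  intro p
  have : ⁅NN, D1⁆ = 0 := by
    apply MvPolynomial.derivation_ext
    intro i
    rw [Derivation.commutator_apply]
    fin_cases i <;>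
    simp [D1, NN, Dg, mkDerivation_X, Derivation.leibniz]
    all_goals simp [← map_ofNat C, derivation_C]
  have h2 := congrArg (fun D => D p) this
  simp only [Derivation.commutator_apply] at h2
  exact sub_eq_zero.1 h2

theorem lieND2 : ∀ p, NN (D2 p) = D2 (NN p) := by
  intro p
  have : ⁅NN, D2⁆ = 0 := by
    apply MvPolynomial.derivation_ext
    intro i
    rw [Derivation.commutator_apply]
    fin_cases i <;>
    simp [D2, NN, Dg, mkDerivation_X, Derivation.leibniz]
    all_goals simp [← map_ofNat C, derivation_C]
  have h2 := congrArg (fun D => D p) this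
  simp only [Derivation.commutator_apply] at h2
  exact sub_eq_zero.1 h2

def wt (l : Fin 8 →₀ ℕ) : ℤ := ∑ i : Fin 8, (7 - 2 * ((i : ℕ) : ℤ)) * (l i : ℤ)

def S (d : ℕ) (h : ℤ) : Finset (Fin 8 →₀ ℕ) := (finsuppAntidiag univ d).filter (fun l => wt l = h)

theorem mem_S {d : ℕ} {h : ℤ} {l : Fin 8 →₀ ℕ} : l ∈ S d h ↔ (∑ i, l i = d) ∧ wt l = h := by
  simp [S, mem_finsuppAntidiag]

noncomputable def V (d : ℕ) (h : ℤ) : Submodule ℂ (MvPolynomial (Fin 8) ℂ) :=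
  restrictSupport ℂ (S d h : Set (Fin 8 →₀ ℕ))

theorem mem_V {d : ℕ} {h : ℤ} {p : MvPolynomial (Fin 8) ℂ} :
    p ∈ V d h ↔ NN p = (d : ℂ) • p ∧ HH p = (h : ℂ) • p := by
  have hN : ∀ l : Fin 8 →₀ ℕ, (∑ i, (1 : ℂ) * (l i : ℂ)) = ((∑ i, l i : ℕ) : ℂ) := by
    intro l; simp
  have hH : ∀ l : Fin 8 →₀ ℕ, (∑ i : Fin 8, (7 - 2 * ((i : ℕ) : ℂ)) * (l i : ℂ)) = ((wt l : ℤ) : ℂ) := by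
    intro l; simp [wt]
  rw [V, mem_restrictSupport_iff]
  constructor
  · intro hs
    constructor
    · ext l
      rw [NN, coeff_Dg, coeff_smul, hN]
      by_cases hl : coeff l p = 0
      · simp [hl]
      · have := mem_S.1 (hs (mem_support_iff.2 hl)); rw [this.1]; rfl
    · ext l
      rw [HH, coeff_Dg, coeff_smul, hH]
      by_cases hl : coeff l p = 0
      · simp [hl]
      · have := mem_S.1 (hs (mem_support_iff.2 hl)); rw [this.2]; rfl
  · rintro ⟨h1, h2⟩ l hl
    have hl := mem_support_iff.1 hl
    have e1 := congrArg (coeff l) h1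
    have e2 := congrArg (coeff l) h2
    rw [NN, coeff_Dg, coeff_smul, hN] at e1
    rw [HH, coeff_Dg, coeff_smul, hH] at e2
    refine mem_coe.2 (mem_S.2 ⟨?_, ?_⟩)
    · exact_mod_cast mul_right_cancel₀ hl e1
    · exact_mod_cast mul_right_cancel₀ hl e2

theorem D1_V {d : ℕ} {h : ℤ} {p} (hp : p ∈ V d h) : D1 p ∈ V d (h + 2) := by
  rw [mem_V] at *
  refine ⟨?_, ?_⟩
  · rw [lieND1, hp.1, Derivation.map_smul]
  · rw [lieHD1, hp.2, Derivation.map_smul]; push_cast; rw [add_smul, ofNat_smul_eq_nsmul, two_nsmul, two_mul]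

theorem D2_V {d : ℕ} {h : ℤ} {p} (hp : p ∈ V d h) : D2 p ∈ V d (h - 2) := by
  rw [mem_V] at *
  refine ⟨?_, ?_⟩
  · rw [lieND2, hp.1, Derivation.map_smul]
  · rw [lieHD2, hp.2, Derivation.map_smul]; push_cast; rw [sub_smul, ofNat_smul_eq_nsmul, two_nsmul, two_mul]

theorem V_eq_zero {d : ℕ} {h : ℤ} (hh : 7 * (d : ℤ) < h) {p} (hp : p ∈ V d h) : p = 0 := by
  have : S d h = ∅ := by
    rw [Finset.eq_empty_iff_forall_notMem]
    intro l hl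
    obtain ⟨h1, h2⟩ := mem_S.1 hl
    have : wt l ≤ ∑ i, 7 * (l i : ℤ) := by
      refine Finset.sum_le_sum fun i _ => ?_
      have : (0 : ℤ) ≤ (l i : ℤ) := by positivity
      nlinarith
    rw [← Finset.mul_sum] at this
    have h3 : (∑ i, (l i : ℤ)) = d := by exact_mod_cast h1
    rw [h3] at this
    omega
  rw [V, this, mem_restrictSupport_iff] at hp
  simpa using hp

theorem iter_V {d : ℕ} {h : ℤ} {p} (hp : p ∈ V d h) (n : ℕ) : D1^[n] p ∈ V d (h + 2 * n) := by
  induction n with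
  | zero => simpa using hp
  | succ n ih =>
    rw [Function.iterate_succ_apply']
    have := D1_V ih
    convert this using 2
    push_cast; ring

theorem iter_comm {d : ℕ} {h : ℤ} {p} (hp : p ∈ V d h) (n : ℕ) :
    D1^[n] (D2 p) = D2 (D1^[n] p) + ((n : ℂ) * (h + n - 1)) • D1^[n-1] p := by
  induction n with
  | zero => simp
  | succ n ih =>
    rw [Function.iterate_succ_apply', ih, map_add, lieD, Derivation.map_smul,
      (mem_V.1 (iter_V hp n)).2, ← Function.iterate_succ_apply' (f := D1) n]
    have : (((n : ℂ) * (h + n - 1)) • D1 (D1^[n-1] p)) = ((n : ℂ) * (h + n - 1)) • D1^[n] p := by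
      cases n with
      | zero => simp
      | succ k => rw [Function.iterate_succ_apply' (f := D1) k]; rfl
    rw [this, add_assoc, ← add_smul]
    congr 2
    push_cast; ring

theorem D1_iter_map_sub (n : ℕ) (a b : MvPolynomial (Fin 8) ℂ) (c : ℂ) :
    D1^[n] (a - c • b) = D1^[n] a - c • D1^[n] b := by
  induction n with
  | zero => rfl
  | succ n ih => simp only [Function.iterate_succ_apply', ih, map_sub, Derivation.map_smul]

theorem surj_aux {d : ℕ} {h : ℤ} (hh : 1 ≤ h) (n : ℕ) : ∀ p ∈ V d h, D1^[n] p = 0 →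
    ∃ r ∈ V d (h - 2), D1 r = p := by
  induction n with
  | zero => intro p hp h0; exact ⟨0, zero_mem _, by simpa using h0.symm⟩
  | succ n ih =>
    intro p hp h0
    set c : ℂ := ((n + 1 : ℕ) : ℂ) * (h + (n + 1 : ℕ) - 1) with hc
    have hc0 : c ≠ 0 := by
      have : c = (((n + 1 : ℤ) * (h + n) : ℤ) : ℂ) := by rw [hc]; push_cast; ring
      rw [this]
      have : (0:ℤ) < (n + 1 : ℤ) * (h + n) := by positivity
      exact_mod_cast this.ne'
    have hFp := D2_V hp
    have hEF : D1 (D2 p) ∈ V d h := by simpa using D1_V hFp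
    obtain ⟨r, hr, hr2⟩ := ih (p - c⁻¹ • D1 (D2 p)) (Submodule.sub_mem _ hp (Submodule.smul_mem _ _ hEF)) (by
      rw [D1_iter_map_sub, ← Function.iterate_succ_apply (f := D1), iter_comm hp, h0, map_zero, zero_add,
        ← hc, Nat.succ_sub_one, smul_smul, inv_mul_cancel₀ hc0, one_smul, sub_self])
    refine ⟨r + c⁻¹ • D2 p, Submodule.add_mem _ hr (Submodule.smul_mem _ _ hFp), ?_⟩
    rw [map_add, Derivation.map_smul, hr2]; ring

theorem surj {d : ℕ} {h : ℤ} (hh : 1 ≤ h) : ∀ p ∈ V d h, ∃ r ∈ V d (h - 2), D1 r = p := by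
  intro p hp
  refine surj_aux hh (7 * d + 1) p hp (V_eq_zero ?_ (iter_V hp _))
  push_cast; linarith

instance (d : ℕ) (h : ℤ) : FiniteDimensional ℂ (V d h) :=
  Module.Finite.of_basis (basisRestrictSupport ℂ (S d h : Set (Fin 8 →₀ ℕ)))

theorem finrank_V (d : ℕ) (h : ℤ) : Module.finrank ℂ (V d h) = #(S d h) := by
  rw [V, Module.finrank_eq_card_basis (basisRestrictSupport ℂ (S d h : Set (Fin 8 →₀ ℕ)))]
  simp

/-- invariants of degree d -/
noncomputable def Inv (d : ℕ) : Submodule ℂ (MvPolynomial (Fin 8) ℂ) :=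
  homogeneousSubmodule (Fin 8) ℂ d ⊓ LinearMap.ker D1.toLinearMap ⊓ LinearMap.ker D2.toLinearMap

theorem mem_Inv {d : ℕ} {p} : p ∈ Inv d ↔ p.IsHomogeneous d ∧ D1 p = 0 ∧ D2 p = 0 := by
  simp [Inv, and_assoc]

theorem Inv_le_V (d : ℕ) : Inv d ≤ V d 0 := by
  intro p hp
  obtain ⟨h1, h2, h3⟩ := mem_Inv.1 hp
  rw [mem_V]
  constructor
  · ext l
    rw [NN, coeff_Dg, coeff_smul]
    by_cases hl : coeff l p = 0
    · simp [hl]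
    · have := h1 hl
      rw [Finsupp.weight_apply, Finsupp.sum_fintype _ _ (by simp)] at this
      rw [← this]; simp
  · have := lieD p
    rw [h2, h3] at this
    simp at this
    simp [← this]

noncomputable def E0 (d : ℕ) : V d 0 →ₗ[ℂ] V d 2 :=
  (D1.toLinearMap).restrict (fun p hp => by simpa using D1_V (h := 0) hp)

theorem finrank_Inv (d : ℕ) : Module.finrank ℂ (Inv d) + #(S d 2) ≤ #(S d 0) := by
  rw [← finrank_V, ← finrank_V, ← LinearMap.finrank_range_add_finrank_ker (E0 d)]
  have hs : LinearMap.range (E0 d) = ⊤ := by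
    rw [LinearMap.range_eq_top]
    rintro ⟨p, hp⟩
    obtain ⟨r, hr, hr2⟩ := surj (by norm_num) p hp
    exact ⟨⟨r, by simpa using hr⟩, Subtype.ext hr2⟩
  rw [hs, finrank_top]
  have : Module.finrank ℂ (Inv d) ≤ Module.finrank ℂ (LinearMap.ker (E0 d)) := by
    let φ : Inv d →ₗ[ℂ] LinearMap.ker (E0 d) :=
      LinearMap.codRestrict _ (Submodule.inclusion (Inv_le_V d)) (by
        rintro ⟨p, hp⟩
        rw [LinearMap.mem_ker]
        exact Subtype.ext (mem_Inv.1 hp).2.1)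
    refine LinearMap.finrank_le_finrank_of_injective (f := φ) ?_
    intro a b hab
    have : (φ a : V d 0) = φ b := by rw [hab]
    exact Subtype.ext (congrArg (fun x : V d 0 => (x : MvPolynomial (Fin 8) ℂ)) this)
  omega

instance (d : ℕ) : FiniteDimensional ℂ (Inv d) :=
  Submodule.finiteDimensional_of_le (Inv_le_V d)

end Sept


namespace Sept

def Brows : List (List ℤ) := [
  [-1,0,0,0,0,0,0,0], [0,1,1,2,0,0,0,0], [1,-1,0,-3,-1,-2,0,0], [0,0,0,-1,1,1,1,2], 
  [0,2,-2,1,-1,0,1,-2], [1,1,-2,0,-1,0,1,0], [2,-3,1,-1,0,2,-1,0], [3,-3,2,-2,-1,2,-1,0], 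
  [-2,1,-2,-1,2,-1,1,0], [3,4,0,-1,3,-2,2,-1], [4,-4,-5,-4,-3,0,0,0], [5,-1,-3,-2,0,3,5,1], 
  [0,-4,-2,-4,2,4,2,-4], [9,0,2,0,2,4,2,-3], [0,-5,-9,-10,-1,-1,-2,0], [9,3,0,-4,8,6,7,3], 
  [4,-11,-11,-9,-1,-1,4,-8], [12,-1,-1,1,6,8,12,-1], [-2,-10,-10,-13,-2,2,0,-8], 
  [15,3,2,2,10,12,11,1], [2,-14,-15,-22,-1,-4,-1,-10], [14,1,-1,-5,15,14,16,6], 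
  [0,-13,-18,-11,-1,2,5,-18], [17,1,-2,4,12,15,16,-3], [1,-20,-13,-19,-2,0,-3,-12], 
  [17,-3,4,-3,16,19,14,4], [-3,-13,-19,-16,3,-3,3,-18], [14,4,-1,2,19,12,19,-1], 
  [3,-18,-16,-17,-5,2,-1,-16], [15,-4,-3,0,14,20,17,1], [-5,-14,-11,-13,6,1,0,-18], 
  [12,2,4,3,17,13,11,-2], [1,-14,-17,-14,-3,-4,-2,-12], [9,-1,-2,0,16,16,15,3], 
  [0,-12,-8,-7,0,0,2,-18], [9,-4,0,2,9,11,11,-2], [-4,-7,-7,-7,3,3,-4,-10], [5,1,2,0,12,8,5,-1], 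
  [2,-7,-7,-6,1,-3,0,-8], [3,-2,-4,-2,8,6,8,-1], [-2,-4,-2,4,2,4,0,-8], [3,-1,1,4,2,3,1,-5], 
  [0,-4,-1,-4,1,0,-4,0], [1,-2,2,-3,5,4,0,1], [-1,1,-2,1,2,-1,2,-4], [0,1,-2,1,2,-2,3,-3], 
  [1,-2,0,1,-1,3,-2,0], [0,-1,0,1,0,2,-1,-1], [-1,0,1,-1,2,-2,0,0], [0,1,1,1,1,0,0,0], 
  [0,0,-1,-1,-2,-1,-1,0], [0,0,0,0,0,1,1,2], [0,0,0,0,0,0,1,-2]]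
def etaE : List (List (Fin 30)) :=
  [[], [2], [3], [4], [5], [6], [7], [14], [15], [2,2], [2,3], [3,3], [2,4], [2,5], [2,6], [2,7],
  [3,4], [3,7], [2,14], [2,15], [3,14], [3,15], [4,4], [4,5], [4,6], [7,7], [4,14], [4,15],
  [5,14], [5,15], [6,14], [6,15], [10,16], [10,17], [10,18], [10,19], [11,22], [10,26], [10,27],
  [11,26], [11,27], [10,28], [11,28], [16,29]]

def etaO : List (List (Fin 30)) :=
  [[10], [11], [12], [13], [16], [17], [18], [19], [20], [21], [22], [23], [24], [26], [27],
  [2,10], [2,11], [2,12], [2,13], [3,11], [3,12], [3,13], [28], [2,16], [2,17], [2,18], [2,19],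
  [2,20], [2,21], [2,22], [3,22], [29], [2,26], [2,27], [3,26], [3,27], [4,16], [4,17], [4,18],
  [4,19], [2,28], [3,28], [4,26], [4,27]]

section lists
variable {R : Type*} [CommRing R]

def ev1 (q : R) : List ℤ → R
  | [] => 0
  | a :: l => (a : R) + q * ev1 q l

def ev2 (q z : R) : List (List ℤ) → R
  | [] => 0
  | a :: l => ev1 q a + z * ev2 q z l

def add1 : List ℤ → List ℤ → List ℤ
  | [], l => l
  | a :: k, [] => a :: k
  | a :: k, b :: l => (a + b) :: add1 k l

def add2 : List (List ℤ) → List (List ℤ) → List (List ℤ)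
  | [], l => l
  | a :: k, [] => a :: k
  | a :: k, b :: l => (add1 a b) :: add2 k l

def sc1 (c : ℤ) : List ℤ → List ℤ
  | [] => []
  | a :: l => (c * a) :: sc1 c l

def sc2 (c : ℤ) : List (List ℤ) → List (List ℤ)
  | [] => []
  | a :: l => sc1 c a :: sc2 c l

def sh1 : ℕ → List ℤ → List ℤ
  | 0, l => l
  | n + 1, l => 0 :: sh1 n l

def sh2 (n : ℕ) : List (List ℤ) → List (List ℤ)
  | [] => []
  | a :: l => sh1 n a :: sh2 n l

def zsh : ℕ → List (List ℤ) → List (List ℤ)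
  | 0, l => l
  | n + 1, l => [] :: zsh n l

def isZ1 : List ℤ → Bool
  | [] => true
  | a :: l => (a == 0) && isZ1 l

def isZ2 : List (List ℤ) → Bool
  | [] => true
  | a :: l => isZ1 a && isZ2 l

theorem ev1_add (q : R) : ∀ k l, ev1 q (add1 k l) = ev1 q k + ev1 q l
  | [], l => by simp [add1, ev1]
  | a :: k, [] => by simp [add1, ev1]
  | a :: k, b :: l => by simp [add1, ev1, ev1_add q k l]; ring

theorem ev2_add (q z : R) : ∀ k l, ev2 q z (add2 k l) = ev2 q z k + ev2 q z l
  | [], l => by simp [add2, ev2]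
  | a :: k, [] => by simp [add2, ev2]
  | a :: k, b :: l => by simp [add2, ev2, ev1_add, ev2_add q z k l]; ring

theorem ev1_sc (q : R) (c : ℤ) : ∀ l, ev1 q (sc1 c l) = c * ev1 q l
  | [] => by simp [sc1, ev1]
  | a :: l => by simp [sc1, ev1, ev1_sc q c l]; ring

theorem ev2_sc (q z : R) (c : ℤ) : ∀ l, ev2 q z (sc2 c l) = c * ev2 q z l
  | [] => by simp [sc2, ev2]
  | a :: l => by simp [sc2, ev2, ev1_sc, ev2_sc q z c l]; ring

theorem ev1_sh (q : R) : ∀ n l, ev1 q (sh1 n l) = q ^ n * ev1 q l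
  | 0, l => by simp [sh1]
  | n + 1, l => by simp [sh1, ev1, ev1_sh q n l]; ring

theorem ev2_sh (q z : R) (n : ℕ) : ∀ l, ev2 q z (sh2 n l) = q ^ n * ev2 q z l
  | [] => by simp [sh2, ev2]
  | a :: l => by simp [sh2, ev2, ev1_sh, ev2_sh q z n l]; ring

theorem ev2_zsh (q z : R) : ∀ n l, ev2 q z (zsh n l) = z ^ n * ev2 q z l
  | 0, l => by simp [zsh]
  | n + 1, l => by simp [zsh, ev2, ev1, ev2_zsh q z n l]; ring

theorem ev1_isZ (q : R) : ∀ l, isZ1 l = true → ev1 q l = 0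
  | [], _ => rfl
  | a :: l, h => by
    simp [isZ1] at h
    simp [ev1, h.1, ev1_isZ q l h.2]

theorem ev2_isZ (q z : R) : ∀ l, isZ2 l = true → ev2 q z l = 0
  | [], _ => rfl
  | a :: l, h => by
    simp [isZ2] at h
    simp [ev2, ev1_isZ q a h.1, ev2_isZ q z l h.2]

/-- multiply by `1 - z q^a` -/
def mp (a : ℕ) (l : List (List ℤ)) := add2 l (sc2 (-1) (zsh 1 (sh2 a l)))
/-- multiply by `q^a - z` -/
def mm (a : ℕ) (l : List (List ℤ)) := add2 (sh2 a l) (sc2 (-1) (zsh 1 l))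
/-- multiply by `1 - z^a` -/
def mz (a : ℕ) (l : List (List ℤ)) := add2 l (sc2 (-1) (zsh a l))

theorem ev2_mp (q z : R) (a l) : ev2 q z (mp a l) = (1 - z * q ^ a) * ev2 q z l := by
  simp only [mp, ev2_add, ev2_sc, ev2_zsh, ev2_sh]; push_cast; ring
theorem ev2_mm (q z : R) (a l) : ev2 q z (mm a l) = (q ^ a - z) * ev2 q z l := by
  simp only [mm, ev2_add, ev2_sc, ev2_zsh, ev2_sh]; push_cast; ring
theorem ev2_mz (q z : R) (a l) : ev2 q z (mz a l) = (1 - z ^ a) * ev2 q z l := by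
  simp only [mz, ev2_add, ev2_sc, ev2_zsh]; push_cast; ring

def expE : List ℤ → List ℤ
  | [] => []
  | a :: l => 0 :: a :: expE l

def expO : List ℤ → List ℤ
  | [] => [0]
  | a :: l => 0 :: a :: expO l

/-- expand the rows of `B`; the result is `B / q` -/
def expB : Bool → List (List ℤ) → List (List ℤ)
  | _, [] => []
  | true, a :: l => expE a :: expB false l
  | false, a :: l => (expO a).tail :: expB true l

def Bq : List (List ℤ) := expB true Brows

/-- reversal of a row to length 16: `q^16 * B(1/q)` -/
def rv (l : List (List ℤ)) : List (List ℤ) := l.map List.reverse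

theorem ev1_append (q : R) : ∀ k l, ev1 q (k ++ l) = ev1 q k + q ^ k.length * ev1 q l
  | [], l => by simp [ev1]
  | a :: k, l => by simp [ev1, ev1_append q k l]; ring

theorem ev1_reverse (q r : R) (h : q * r = 1) : ∀ l : List ℤ,
    ev1 q l.reverse * r ^ (l.length) = r * ev1 r l
  | [] => by simp [ev1]
  | a :: l => by
    have h2 : q ^ l.length * r ^ l.length = 1 := by rw [← mul_pow, h, one_pow]
    simp only [List.reverse_cons, ev1_append, ev1, List.length_reverse, List.length_cons, mul_zero, add_zero]
    have := ev1_reverse q r h l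
    linear_combination r * this + r * a * h2

def len16 : List (List ℤ) → Bool
  | [] => true
  | a :: l => (a.length == 16) && len16 l

theorem ev2_rv (q r z : R) (h : q * r = 1) : ∀ l : List (List ℤ), len16 l = true →
    ev2 q z (rv l) = q ^ 16 * (r * ev2 r z l)
  | [], _ => by simp [rv, ev2]
  | a :: l, hl => by
    simp [len16] at hl
    have h1 := ev1_reverse q r h a
    rw [hl.1] at h1
    have h2 := ev2_rv q r z h l hl.2
    have h3 : q ^ 16 * r ^ 16 = 1 := by rw [← mul_pow, h, one_pow]
    simp only [rv, List.map_cons, ev2] at h2 ⊢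
    rw [h2]
    linear_combination q ^ 16 * h1 - ev1 q a.reverse * h3

def expsL : List ℕ → List (List ℤ)
  | [] => []
  | a :: l => add2 (zsh a [[1]]) (expsL l)

theorem ev2_expsL (q z : R) : ∀ l, ev2 q z (expsL l) = (l.map (fun a => z ^ a)).sum
  | [] => by simp [expsL, ev2]
  | a :: l => by simp [expsL, ev2_add, ev2_zsh, ev2_expsL q z l, ev2, ev1]

end lists

def mDeg (m : List (Fin 30)) : ℕ := (m.map degs).sum

def exps : List ℕ := (etaE.map mDeg) ++ (etaO.map mDeg)

theorem cert : isZ2 (add2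
    (mz 4 (mz 8 (mz 12 (mz 12 (mz 20 [[0,0,0,0,0,0,0,0,0,0,0,0,0,0,1,0,-2,0,1]])))))
    (add2 (sc2 2 (mp 1 (mp 3 (mp 5 (mp 7 (mm 1 (mm 3 (mm 5 (mm 7 (expsL exps))))))))))
    (add2 (sh2 1 (mm 1 (mm 3 (mm 5 (mm 7 Bq)))))
      (mp 1 (mp 3 (mp 5 (mp 7 (rv Bq)))))))) = true := by
  decide +kernel

theorem Bq16 : len16 Bq = true := by decide +kernel

theorem cert_eq {R : Type*} [CommRing R] (q r z : R) (h : q * r = 1) :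
    (1 - z ^ 4) * (1 - z ^ 8) * (1 - z ^ 12) * (1 - z ^ 12) * (1 - z ^ 20) * (2 - q ^ 2 - r ^ 2)
    = 2 * (exps.map (fun a => z ^ a)).sum *
      ((1 - z * q) * (1 - z * q ^ 3) * (1 - z * q ^ 5) * (1 - z * q ^ 7)) *
      ((1 - z * r) * (1 - z * r ^ 3) * (1 - z * r ^ 5) * (1 - z * r ^ 7)) +
      (q * ev2 q z Bq) * ((1 - z * r) * (1 - z * r ^ 3) * (1 - z * r ^ 5) * (1 - z * r ^ 7)) +
      (r * ev2 r z Bq) * ((1 - z * q) * (1 - z * q ^ 3) * (1 - z * q ^ 5) * (1 - z * q ^ 7)) := by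
  have h1 := ev2_isZ q z _ cert
  simp only [ev2_add, ev2_mp, ev2_mm, ev2_mz, ev2_sc, ev2_sh, ev2_expsL, ev2_rv q r z h _ Bq16] at h1
  have hk : ∀ k : ℕ, q ^ k * r ^ k = 1 := fun k => by rw [← mul_pow, h, one_pow]
  have e1 : ∀ k, 1 - z * r ^ k = r ^ k * (q ^ k - z) := by
    intro k; linear_combination - hk k
  have e2 : (1 - z * r) = r * (q - z) := by linear_combination - h
  rw [e2, e1 3, e1 5, e1 7]
  have e3 : ev2 q z [[0,0,0,0,0,0,0,0,0,0,0,0,0,0,1,0,-2,0,1]] = q ^ 14 - 2 * q ^ 16 + q ^ 18 := by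
    simp [ev2, ev1]; ring
  rw [e3] at h1
  have e4 : r ^ 16 * (q ^ 14 - 2 * q ^ 16 + q ^ 18) = r ^ 2 - 2 + q ^ 2 := by
    linear_combination r ^ 2 * hk 14 - 2 * hk 16 + q ^ 2 * hk 16
  generalize ev2 q z Bq = b at *
  generalize ev2 r z Bq = b' at *
  generalize (exps.map (fun a => z ^ a)).sum = P at *
  push_cast at h1
  linear_combination (-r ^ 16) * h1 + ((1 - z ^ 4) * (1 - z ^ 8) * (1 - z ^ 12) * (1 - z ^ 12) * (1 - z ^ 20)) * e4 + (r * b' * ((1 - z * q) * (1 - z * q ^ 3) * (1 - z * q ^ 5) * (1 - z * q ^ 7))) * hk 16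

end Sept


namespace Sept

abbrev LZ := LaurentPolynomial ℤ
noncomputable abbrev TT (n : ℤ) : LZ := LaurentPolynomial.T n

theorem geom_inv {A : Type*} [CommRing A] (a : A) :
    (1 - PowerSeries.X * PowerSeries.C a) * PowerSeries.mk (fun n => a ^ n) = 1 := by
  rw [sub_mul, one_mul, mul_assoc]
  ext n
  cases n with
  | zero => simp
  | succ n =>
    simp only [map_sub, PowerSeries.coeff_mk, PowerSeries.coeff_succ_X_mul, PowerSeries.coeff_C_mul, PowerSeries.coeff_one]
    simp [pow_succ']

/-- generating function factors -/
noncomputable def gf (a : ℤ) : PowerSeries LZ := PowerSeries.mk (fun n => (TT a) ^ n)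

noncomputable def FF : PowerSeries LZ := ∏ i : Fin 8, gf (7 - 2 * ((i : ℕ) : ℤ))

theorem coeff_FF (d : ℕ) : PowerSeries.coeff d FF = ∑ l ∈ finsuppAntidiag (univ : Finset (Fin 8)) d, TT (wt l) := by
  rw [FF, PowerSeries.coeff_prod]
  refine Finset.sum_congr rfl fun l _ => ?_
  have : ∀ (s : Finset (Fin 8)) (f : Fin 8 → ℤ), ∏ i ∈ s, TT (f i) = TT (∑ i ∈ s, f i) := by
    intro s f
    induction s using Finset.induction_on with
    | empty => simp [TT]
    | insert a s ha ih => rw [Finset.prod_insert ha, Finset.sum_insert ha, ih, TT, TT, TT, LaurentPolynomial.T_add]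
  rw [wt, ← this]
  refine Finset.prod_congr rfl fun i _ => ?_
  rw [gf, PowerSeries.coeff_mk, TT, LaurentPolynomial.T_pow, mul_comm]

noncomputable def ct (f : PowerSeries LZ) : PowerSeries ℤ := PowerSeries.mk fun n => (PowerSeries.coeff n f).coeff 0

theorem ct_add (f g) : ct (f + g) = ct f + ct g := by
  ext n; simp [ct]

theorem ct_mapC_mul (Q : PowerSeries ℤ) (f) :
    ct (PowerSeries.map LaurentPolynomial.C Q * f) = Q * ct f := by
  ext n
  simp only [ct, PowerSeries.coeff_mk, PowerSeries.coeff_mul, PowerSeries.coeff_map]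
  rw [AddMonoidAlgebra.coeff_sum, Finsupp.finsetSum_apply]
  refine Finset.sum_congr rfl fun x _ => ?_
  rw [← LaurentPolynomial.smul_eq_C_mul, AddMonoidAlgebra.coeff_smul, Finsupp.smul_apply, smul_eq_mul]

theorem ct_FF (k : ℤ) (d : ℕ) : PowerSeries.coeff d (ct (PowerSeries.C (TT k) * FF)) = (#(S d (-k)) : ℤ) := by
  rw [ct, PowerSeries.coeff_mk, PowerSeries.coeff_C_mul, coeff_FF, Finset.mul_sum, AddMonoidAlgebra.coeff_sum, Finsupp.finsetSum_apply]
  simp only [TT, ← LaurentPolynomial.T_add, LaurentPolynomial.T_apply]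
  rw [S, Finset.card_filter]
  push_cast
  refine Finset.sum_congr rfl fun x _ => ?_
  congr 1
  apply propext; constructor <;> intro h <;> linarith

theorem S_symm (d : ℕ) (h : ℤ) : #(S d (-h)) = #(S d h) := by
  have key : ∀ h' : ℤ, ∀ l ∈ S d h', Finsupp.equivMapDomain Fin.revPerm l ∈ S d (-h') := by
    intro h' l hl
    obtain ⟨h1, h2⟩ := mem_S.1 hl
    refine mem_S.2 ⟨?_, ?_⟩
    · rw [← h1, ← Equiv.sum_comp Fin.revPerm]; simp
    · rw [← h2, wt, wt, ← Equiv.sum_comp Fin.revPerm, ← Finset.sum_neg_distrib]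
      refine Finset.sum_congr rfl fun i _ => ?_
      simp only [Finsupp.equivMapDomain_apply, Fin.revPerm_symm, Fin.revPerm_apply, Fin.rev_rev, Fin.val_rev]
      have e : ((8 - ((i : ℕ) + 1) : ℕ) : ℤ) = 7 - i := by have := i.2; omega
      rw [e]
      ring
  refine Finset.card_bij' (fun l _ => Finsupp.equivMapDomain Fin.revPerm l) (fun l _ => Finsupp.equivMapDomain Fin.revPerm l)
    (fun l hl => by simpa using key _ l hl) (fun l hl => key _ l hl) ?_ ?_ <;>
  · intro l _
    ext i
    simp [Finsupp.equivMapDomain_apply]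

noncomputable def iota : PowerSeries (Polynomial ℤ) →+* PowerSeries LZ := PowerSeries.map Polynomial.toLaurent
noncomputable def sig : PowerSeries LZ →+* PowerSeries LZ :=
  PowerSeries.map (LaurentPolynomial.invert : LZ ≃ₐ[ℤ] LZ).toAlgHom.toRingHom

theorem ct_iota (f) : ct (iota (PowerSeries.C Polynomial.X * f)) = 0 := by
  ext n
  have : ((0 : ℤ)) = ((0 : ℕ) : ℤ) := rfl
  rw [ct, PowerSeries.coeff_mk, iota, PowerSeries.coeff_map, PowerSeries.coeff_C_mul]
  rw [this, LaurentPolynomial.coeff_toLaurent]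
  have h2 := Finsupp.mapDomain_apply (f := ((↑) : ℕ → ℤ)) Nat.cast_injective
    (Polynomial.X * (PowerSeries.coeff n) f).toFinsupp.coeff 0
  refine h2.trans ?_
  change Polynomial.coeff (Polynomial.X * (PowerSeries.coeff n) f) 0 = _
  simp

theorem ct_sig (f) : ct (sig f) = ct f := by
  ext n
  simp [ct, sig, PowerSeries.coeff_map, LaurentPolynomial.invert_apply]

noncomputable def gp (a : ℕ) : PowerSeries (Polynomial ℤ) := PowerSeries.mk (fun n => (Polynomial.X ^ a) ^ n)

theorem iota_gp (a : ℕ) : iota (gp a) = gf a := by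
  ext1 n; simp [iota, gp, gf, PowerSeries.coeff_map, TT]

theorem sig_gf (a : ℤ) : sig (gf a) = gf (-a) := by
  ext1 n; simp [sig, gf, PowerSeries.coeff_map, TT]

theorem map_ev1 {R R' : Type*} [CommRing R] [CommRing R'] (f : R →+* R') (q : R) : ∀ l, f (ev1 q l) = ev1 (f q) l
  | [] => by simp [ev1]
  | a :: l => by simp [ev1, map_ev1 f q l]
theorem map_ev2 {R R' : Type*} [CommRing R] [CommRing R'] (f : R →+* R') (q z : R) : ∀ l, f (ev2 q z l) = ev2 (f q) (f z) l
  | [] => by simp [ev2]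
  | a :: l => by simp [ev2, map_ev1, map_ev2 f q z l]

noncomputable def QQ : PowerSeries ℤ := (1 - PowerSeries.X ^ 4) * (1 - PowerSeries.X ^ 8) *
  (1 - PowerSeries.X ^ 12) * (1 - PowerSeries.X ^ 12) * (1 - PowerSeries.X ^ 20)
noncomputable def PP : PowerSeries ℤ := (exps.map (fun a => PowerSeries.X ^ a)).sum

noncomputable def GG : PowerSeries ℤ := PowerSeries.mk fun d => (#(S d 0) : ℤ) - #(S d 2)

theorem QQGG : QQ * GG = PP := by
  set z : PowerSeries LZ := PowerSeries.X with hz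
  set q : PowerSeries LZ := PowerSeries.C (TT 1) with hq
  set r : PowerSeries LZ := PowerSeries.C (TT (-1)) with hr
  have hqr : q * r = 1 := by rw [hq, hr, ← map_mul, TT, TT, ← LaurentPolynomial.T_add]; simp
  have hC := cert_eq q r z hqr
  have hg : ∀ k : ℕ, (1 - z * q ^ k) * gf k = 1 := by
    intro k
    have := geom_inv (TT k)
    rw [hq, ← map_pow, TT, LaurentPolynomial.T_pow, mul_one]; exact this
  have hg' : ∀ k : ℕ, (1 - z * r ^ k) * gf (-k) = 1 := by
    intro k
    have := geom_inv (TT (-k))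
    rw [hr, ← map_pow, TT, LaurentPolynomial.T_pow, mul_neg_one]; exact this
  have g1 := hg 1; have g3 := hg 3; have g5 := hg 5; have g7 := hg 7
  have g1' := hg' 1; have g3' := hg' 3; have g5' := hg' 5; have g7' := hg' 7
  rw [pow_one] at g1 g1'
  push_cast at g1 g3 g5 g7 g1' g3' g5' g7'
  have hF : FF = (gf 7 * gf 5 * gf 3 * gf 1) * (gf (-1) * gf (-3) * gf (-5) * gf (-7)) := by
    rw [FF, Fin.prod_univ_eight]
    norm_num
    ring
  set Gp := gf 7 * gf 5 * gf 3 * gf 1 with hGp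
  set Gm := gf (-1) * gf (-3) * gf (-5) * gf (-7) with hGm
  have hp : ((1 - z * q) * (1 - z * q ^ 3) * (1 - z * q ^ 5) * (1 - z * q ^ 7)) * Gp = 1 := by
    rw [hGp]
    calc _ = ((1 - z * q) * gf 1) * ((1 - z * q ^ 3) * gf 3) * ((1 - z * q ^ 5) * gf 5) * ((1 - z * q ^ 7) * gf 7) := by ring
      _ = 1 := by rw [g1, g3, g5, g7]; ring
  have hm : ((1 - z * r) * (1 - z * r ^ 3) * (1 - z * r ^ 5) * (1 - z * r ^ 7)) * Gm = 1 := by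
    rw [hGm]
    calc _ = ((1 - z * r) * gf (-1)) * ((1 - z * r ^ 3) * gf (-3)) * ((1 - z * r ^ 5) * gf (-5)) * ((1 - z * r ^ 7) * gf (-7)) := by ring
      _ = 1 := by rw [g1', g3', g5', g7']; ring
  set W : PowerSeries (Polynomial ℤ) := PowerSeries.C Polynomial.X * (ev2 (PowerSeries.C Polynomial.X) PowerSeries.X Bq * (gp 7 * gp 5 * gp 3 * gp 1)) with hW
  have iz : iota PowerSeries.X = z := by simp [iota, hz]
  have iq : iota (PowerSeries.C Polynomial.X) = q := by simp [iota, hq, TT]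
  have sz : sig z = z := by simp [sig, hz]
  have sq : sig q = r := by simp [sig, hq, hr, TT]
  have hiW : iota W = q * ev2 q z Bq * Gp := by
    rw [hW, map_mul, map_mul, map_mul, map_mul, map_mul, map_ev2, iota_gp, iota_gp, iota_gp, iota_gp, iz, iq, hGp]
    push_cast; ring
  have hsW : sig (iota W) = r * ev2 r z Bq * Gm := by
    rw [hiW, hGp, map_mul, map_mul, map_mul, map_mul, map_mul, map_ev2, sig_gf, sig_gf, sig_gf, sig_gf, sz, sq, hGm]
    ring
  have hQ : PowerSeries.map LaurentPolynomial.C QQ = (1 - z ^ 4) * (1 - z ^ 8) * (1 - z ^ 12) * (1 - z ^ 12) * (1 - z ^ 20) := by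
    simp [QQ, hz]
  have hP : PowerSeries.map LaurentPolynomial.C PP = (exps.map (fun a => z ^ a)).sum := by
    rw [PP, map_list_sum, List.map_map]; congr 1
    refine List.map_congr_left fun a _ => ?_
    simp [hz]
  have main : PowerSeries.map LaurentPolynomial.C QQ * ((2 - q ^ 2 - r ^ 2) * FF) =
      PowerSeries.map LaurentPolynomial.C (2 * PP) * 1 + (iota W + sig (iota W)) := by
    rw [map_mul _ 2, hP, hQ, hsW, hiW, hF, map_ofNat]
    set a := ((1 - z * q) * (1 - z * q ^ 3) * (1 - z * q ^ 5) * (1 - z * q ^ 7))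
    set b := ((1 - z * r) * (1 - z * r ^ 3) * (1 - z * r ^ 5) * (1 - z * r ^ 7))
    linear_combination (Gp * Gm) * hC + (2 * (exps.map (fun a => z ^ a)).sum * b * Gm + r * ev2 r z Bq * Gm) * hp
      + (2 * (exps.map (fun a => z ^ a)).sum + q * ev2 q z Bq * Gp) * hm
  have h2 := congrArg ct main
  rw [ct_mapC_mul, ct_add, ct_mapC_mul, ct_add, ct_sig, hW, ct_iota, add_zero, add_zero] at h2
  have h1 : ct 1 = 1 := by
    ext n; simp only [ct, PowerSeries.coeff_mk, PowerSeries.coeff_one]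
    split_ifs <;> simp
  have h3 : ct ((2 - q ^ 2 - r ^ 2) * FF) = 2 * GG := by
    have e : (2 - q ^ 2 - r ^ 2) * FF = PowerSeries.map LaurentPolynomial.C 2 * (PowerSeries.C (TT 0) * FF)
       + (PowerSeries.map LaurentPolynomial.C (-1) * (PowerSeries.C (TT 2) * FF) + PowerSeries.map LaurentPolynomial.C (-1) * (PowerSeries.C (TT (-2)) * FF)) := by
      rw [hq, hr, ← map_pow, ← map_pow, TT, TT, LaurentPolynomial.T_pow, LaurentPolynomial.T_pow]
      simp only [TT, LaurentPolynomial.T_zero, map_one, map_neg, map_ofNat]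
      norm_num
      ring
    rw [e, ct_add, ct_add, ct_mapC_mul, ct_mapC_mul, ct_mapC_mul]
    have e0 : ct (PowerSeries.C (TT 0) * FF) = PowerSeries.mk fun d => (#(S d 0) : ℤ) := by
      ext d; rw [ct_FF]; simp
    have e2 : ct (PowerSeries.C (TT 2) * FF) = PowerSeries.mk fun d => (#(S d 2) : ℤ) := by
      ext d; rw [ct_FF, S_symm]; simp
    have e2' : ct (PowerSeries.C (TT (-2)) * FF) = PowerSeries.mk fun d => (#(S d 2) : ℤ) := by
      ext d; rw [ct_FF]; simp
    have e3 : GG = (PowerSeries.mk fun d => (#(S d 0) : ℤ)) - PowerSeries.mk fun d => (#(S d 2) : ℤ) := by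
      ext d; simp [GG]
    rw [e0, e2, e2', e3]; ring
  rw [h1, h3, mul_one] at h2
  have : (2 : PowerSeries ℤ) ≠ 0 := by
    intro h; have := congrArg (PowerSeries.coeff 0) h
    rw [show (2 : PowerSeries ℤ) = PowerSeries.C (2 : ℤ) by simp, PowerSeries.coeff_zero_C, map_zero] at this
    exact two_ne_zero this
  apply mul_left_cancel₀ this
  linear_combination h2

def td : Fin 5 → ℕ := ![4, 8, 12, 12, 20]

theorem td_pos (m : Fin 5) : 0 < td m := by fin_cases m <;> decide

def AA (e : ℕ) : Finset (Fin 5 →₀ ℕ) := (finsuppAntidiag univ e).filter (fun l => ∀ m, td m ∣ l m)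

def etaL (x : Fin 2 × Fin 44) : List (Fin 30) := (if x.1 = 0 then etaE else etaO).getD x.2 []

def JJ (d : ℕ) : Finset ((_ : Fin 2 × Fin 44) × (Fin 5 →₀ ℕ)) :=
  univ.sigma fun x => if mDeg (etaL x) ≤ d then AA (d - mDeg (etaL x)) else ∅

noncomputable def dv (k : ℕ) : PowerSeries ℤ := PowerSeries.mk fun n => if k ∣ n then 1 else 0

theorem dv_inv (k : ℕ) (hk : 0 < k) : (1 - PowerSeries.X ^ k) * dv k = 1 := by
  ext n
  rw [sub_mul, one_mul, map_sub, PowerSeries.coeff_X_pow_mul', dv, PowerSeries.coeff_mk, PowerSeries.coeff_mk,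
    PowerSeries.coeff_one]
  by_cases h : k ≤ n
  · have h1 : n ≠ 0 := by omega
    simp [h, h1, Nat.dvd_sub_self_right]
    by_cases h2 : k ∣ n <;> simp [h2]
    exact lt_of_le_of_ne h (fun e => h2 (e ▸ dvd_rfl))
  · by_cases h1 : n = 0
    · simp [h1]; intro h2; omega
    · have : ¬ k ∣ n := fun h2 => h (Nat.le_of_dvd (by omega) h2)
      simp [h, h1, this]

noncomputable def HH5 : PowerSeries ℤ := ∏ m : Fin 5, dv (td m)

theorem coeff_HH5 (e : ℕ) : PowerSeries.coeff e HH5 = (#(AA e) : ℤ) := by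
  rw [HH5, PowerSeries.coeff_prod, AA, Finset.card_filter]
  push_cast
  refine Finset.sum_congr rfl fun l _ => ?_
  simp only [dv, PowerSeries.coeff_mk]
  rw [Finset.prod_ite_zero]
  simp

theorem etaE_len : etaE.length = 44 := by decide +kernel
theorem etaO_len : etaO.length = 44 := by decide +kernel

theorem sum_getD {α M : Type*} [AddCommMonoid M] (L : List α) (n : ℕ) (h : L.length = n) (a : α) (f : α → M) :
    ∑ i : Fin n, f (L.getD i a) = (L.map f).sum := by
  subst h
  rw [← Fin.sum_univ_getElem]
  refine Fintype.sum_equiv (finCongr (by simp)) _ _ fun i => ?_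
  simp

theorem PP_eq : PP = ∑ x : Fin 2 × Fin 44, PowerSeries.X ^ mDeg (etaL x) := by
  rw [PP, exps, Fintype.sum_prod_type, Fin.sum_univ_two, List.map_append, List.sum_append]
  congr 1

theorem card_JJ (d : ℕ) : #(S d 0) = #(S d 2) + #(JJ d) := by
  have h1 : GG = PP * HH5 := by
    have : QQ * HH5 = 1 := by
      rw [HH5, Fin.prod_univ_five, QQ]
      have e := fun k hk => dv_inv k hk
      simp only [td, Matrix.cons_val]
      have a := e 4 (by norm_num); have b := e 8 (by norm_num); have c := e 12 (by norm_num)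
      have d := e 20 (by norm_num)
      calc _ = ((1 - PowerSeries.X ^ 4) * dv 4) * ((1 - PowerSeries.X ^ 8) * dv 8) *
            ((1 - PowerSeries.X ^ 12) * dv 12) * ((1 - PowerSeries.X ^ 12) * dv 12) *
            ((1 - PowerSeries.X ^ 20) * dv 20) := by ring
        _ = 1 := by rw [a, b, c, d]; ring
    linear_combination HH5 * QQGG - GG * this
  have h2 := congrArg (PowerSeries.coeff d) h1
  rw [PP_eq, Finset.sum_mul, map_sum, GG, PowerSeries.coeff_mk] at h2
  have h3 : (#(JJ d) : ℤ) = ∑ x : Fin 2 × Fin 44, PowerSeries.coeff d (PowerSeries.X ^ mDeg (etaL x) * HH5) := by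
    rw [JJ, Finset.card_sigma]
    push_cast
    refine Finset.sum_congr rfl fun x _ => ?_
    rw [PowerSeries.coeff_X_pow_mul']
    split_ifs with h
    · rw [coeff_HH5]
    · simp
  rw [← h3] at h2
  omega

end Sept


namespace Sept

/-- the weight term -/
def wt1 (k m n a b i : ℕ) : ℕ :=
  k.choose i * ((m - a).descFactorial (k - i) * a.descFactorial i) *
    ((n - b).descFactorial i * b.descFactorial (k - i))
def wP (k m n a b : ℕ) : ℕ := ((List.range (k + 1)).map fun i => if i % 2 = 0 then wt1 k m n a b i else 0).sum
def wN (k m n a b : ℕ) : ℕ := ((List.range (k + 1)).map fun i => if i % 2 = 0 then 0 else wt1 k m n a b i).sum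
def wZ (k m n a b : ℕ) : ℤ := (wP k m n a b : ℤ) - wN k m n a b

structure Ops (A : Type*) where
  z : A
  lin : List ((ℕ × ℕ) × A × A) → A

def ringOps (R : Type*) [CommRing R] : Ops R where
  z := 0
  lin L := (L.map fun x => ((x.1.1 : R) - (x.1.2 : R)) * x.2.1 * x.2.2).sum

section prog
variable {A : Type*} (O : Ops A)

def trList (k : ℕ) (F G : List A) (l : ℕ) : List ((ℕ × ℕ) × A × A) :=
  ((List.range (l + k + 1)).map fun j =>
    ((wP k (F.length - 1) (G.length - 1) j (l + k - j), wN k (F.length - 1) (G.length - 1) j (l + k - j)),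
      F.getD j O.z, G.getD (l + k - j) O.z)).take 16

def trans (k : ℕ) (F G : List A) : List A :=
  (List.range ((F.length - 1) + (G.length - 1) + 1 - 2 * k)).map fun l => O.lin (trList O k F G l)

def run : List (ℕ × ℕ × ℕ) → List (List A) → List (List A)
  | [], st => st
  | i :: is, st => run is (trans O i.2.2 (st.getD i.1 []) (st.getD i.2.1 []) :: st)

end prog

section param
variable {A B : Type*} (O : Ops A) (O' : Ops B) (ρ : A → B → Prop)

def rel3 : ((ℕ × ℕ) × A × A) → ((ℕ × ℕ) × B × B) → Prop :=
  fun x y => x.1 = y.1 ∧ ρ x.2.1 y.2.1 ∧ ρ x.2.2 y.2.2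

variable {ρ}
theorem getD_rel {α β : Type*} {r : α → β → Prop} {z : α} {z' : β} (hz : r z z') {L : List α} {L' : List β}
    (h : List.Forall₂ r L L') (j : ℕ) : r (L.getD j z) (L'.getD j z') := by
  induction h generalizing j with
  | nil => simpa using hz
  | cons h _ ih =>
    cases j with
    | zero => simpa using h
    | succ j => simpa using ih j

theorem map_rel {α β γ : Type*} {r : α → β → Prop} (f : γ → α) (g : γ → β) (h : ∀ c, r (f c) (g c)) (L : List γ) :
    List.Forall₂ r (L.map f) (L.map g) := by
  induction L with
  | nil => exact .nil
  | cons a l ih => exact .cons (h a) ih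

theorem take_rel {α β : Type*} {r : α → β → Prop} {L : List α} {L' : List β}
    (h : List.Forall₂ r L L') (j : ℕ) : List.Forall₂ r (L.take j) (L'.take j) := by
  induction h generalizing j with
  | nil => simp
  | cons h _ ih =>
    cases j with
    | zero => simp
    | succ j => exact .cons h (ih j)

theorem trans_rel (hz : ρ O.z O'.z)
    (hl : ∀ L L', L.length ≤ 16 → List.Forall₂ (rel3 ρ) L L' → ρ (O.lin L) (O'.lin L'))
    (k : ℕ) {F G F' G'} (hF : List.Forall₂ ρ F F') (hG : List.Forall₂ ρ G G') :
    List.Forall₂ ρ (trans O k F G) (trans O' k F' G') := by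
  rw [trans, trans, hF.length_eq, hG.length_eq]
  refine map_rel _ _ (fun l => hl _ _ (by rw [trList, List.length_take]; omega) ?_) _
  rw [trList, trList, hF.length_eq, hG.length_eq]
  refine take_rel (map_rel _ _ (fun j => ⟨rfl, getD_rel hz hF _, getD_rel hz hG _⟩) _) _

theorem run_rel (hz : ρ O.z O'.z)
    (hl : ∀ L L', L.length ≤ 16 → List.Forall₂ (rel3 ρ) L L' → ρ (O.lin L) (O'.lin L'))
    (is : List (ℕ × ℕ × ℕ)) : ∀ {st st'}, List.Forall₂ (List.Forall₂ ρ) st st' →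
    List.Forall₂ (List.Forall₂ ρ) (run O is st) (run O' is st') := by
  induction is with
  | nil => intro st st' h; exact h
  | cons i is ih =>
    intro st st' h
    exact ih (.cons (trans_rel O O' hz hl _ (getD_rel .nil h _) (getD_rel .nil h _)) h)
end param

theorem ringOps_lin_rel {R R' : Type*} [CommRing R] [CommRing R'] (f : R →+* R') (L L')
    (h : List.Forall₂ (rel3 fun a b => f a = b) L L') : f ((ringOps R).lin L) = (ringOps R').lin L' := by
  induction h with
  | nil => simp [ringOps]
  | cons h _ ih =>
    obtain ⟨h1, h2, h3⟩ := h
    simp only [ringOps, List.map_cons, List.sum_cons, map_add, map_mul, map_sub, map_natCast, h1, h2, h3] at ih ⊢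
    rw [ih]

/-- coefficient form of covariants -/
structure Cov (m d : ℕ) (F : ℕ → MvPolynomial (Fin 8) ℂ) : Prop where
  hom : ∀ l, (F l).IsHomogeneous d
  zero : ∀ l, m < l → F l = 0
  d10 : D1 (F 0) = 0
  d1 : ∀ l, D1 (F (l + 1)) = ((m : ℂ) - l) • F l
  d2 : ∀ l, D2 (F l) = ((l : ℂ) + 1) • F (l + 1)

noncomputable def tr (k m n : ℕ) (F G : ℕ → MvPolynomial (Fin 8) ℂ) (l : ℕ) : MvPolynomial (Fin 8) ℂ :=
  ∑ x ∈ antidiagonal (l + k), ((wZ k m n x.1 x.2 : ℤ) : ℂ) • (F x.1 * G x.2)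

def wOK (k m n : ℕ) : Bool :=
  (List.range (m + 1)).all fun a => (List.range (n + 1)).all fun b =>
    decide (wZ k m n (a + 1) b * ((m : ℤ) - a) + wZ k m n a (b + 1) * ((n : ℤ) - b)
        = ((m : ℤ) + n - k - a - b) * wZ k m n a b) &&
    decide ((a : ℤ) * wZ k m n (a - 1) b + b * wZ k m n a (b - 1) = ((a : ℤ) + b - k) * wZ k m n a b) &&
    decide (m + n - k < a + b → wZ k m n a b = 0) && decide (a + b < k → wZ k m n a b = 0)

theorem wOK_spec {k m n : ℕ} (h : wOK k m n = true) {a b : ℕ} (ha : a ≤ m) (hb : b ≤ n) :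
    (wZ k m n (a + 1) b * ((m : ℤ) - a) + wZ k m n a (b + 1) * ((n : ℤ) - b)
        = ((m : ℤ) + n - k - a - b) * wZ k m n a b) ∧
    ((a : ℤ) * wZ k m n (a - 1) b + b * wZ k m n a (b - 1) = ((a : ℤ) + b - k) * wZ k m n a b) ∧
    (m + n - k < a + b → wZ k m n a b = 0) ∧ (a + b < k → wZ k m n a b = 0) := by
  rw [wOK, List.all_eq_true] at h
  have h1 := h a (by simp; omega)
  rw [List.all_eq_true] at h1
  have h2 := h1 b (by simp; omega)
  simp only [Bool.and_eq_true, decide_eq_true_eq] at h2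
  tauto

theorem tr_D1 {k m n : ℕ} (h : wOK k m n = true) {d e F G} (hF : Cov m d F) (hG : Cov n e G) (s : ℕ) :
    D1 (∑ x ∈ antidiagonal (s + 1), ((wZ k m n x.1 x.2 : ℤ) : ℂ) • (F x.1 * G x.2)) =
    ((m : ℂ) + n - k - s) • ∑ x ∈ antidiagonal s, ((wZ k m n x.1 x.2 : ℤ) : ℂ) • (F x.1 * G x.2) := by
  simp only [map_sum, Derivation.map_smul, Derivation.leibniz, smul_eq_mul, smul_add, Finset.sum_add_distrib]
  rw [Finset.Nat.sum_antidiagonal_succ', Finset.Nat.sum_antidiagonal_succ]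
  simp only [hF.d10, hG.d10, hF.d1, hG.d1, mul_zero, smul_zero, zero_add, add_zero]
  rw [← Finset.sum_add_distrib, Finset.smul_sum]
  refine Finset.sum_congr rfl fun x hx => ?_
  rw [HasAntidiagonal.mem_antidiagonal] at hx
  by_cases ha : x.1 ≤ m
  · by_cases hb : x.2 ≤ n
    · have := (wOK_spec h ha hb).1
      have h2 := congrArg (Int.cast : ℤ → ℂ) this
      push_cast at h2
      have hs : (s : ℂ) = x.1 + x.2 := by rw [← hx]; push_cast; rfl
      rw [mul_smul_comm, mul_smul_comm, mul_comm (G x.2), smul_smul, smul_smul, smul_smul, ← add_smul]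
      congr 1
      rw [hs]
      linear_combination h2
    · simp [hG.zero x.2 (by omega)]
  · simp [hF.zero x.1 (by omega)]

theorem tr_D2 {k m n : ℕ} (h : wOK k m n = true) {d e F G} (hF : Cov m d F) (hG : Cov n e G) (s : ℕ) :
    D2 (∑ x ∈ antidiagonal s, ((wZ k m n x.1 x.2 : ℤ) : ℂ) • (F x.1 * G x.2)) =
    ((s : ℂ) + 1 - k) • ∑ x ∈ antidiagonal (s + 1), ((wZ k m n x.1 x.2 : ℤ) : ℂ) • (F x.1 * G x.2) := by
  have key : ∑ x ∈ antidiagonal (s + 1), (((x.1 : ℂ) * (wZ k m n (x.1 - 1) x.2 : ℤ)) • (F x.1 * G x.2) +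
      ((x.2 : ℂ) * (wZ k m n x.1 (x.2 - 1) : ℤ)) • (F x.1 * G x.2)) =
    ((s : ℂ) + 1 - k) • ∑ x ∈ antidiagonal (s + 1), ((wZ k m n x.1 x.2 : ℤ) : ℂ) • (F x.1 * G x.2) := by
    rw [Finset.smul_sum]
    refine Finset.sum_congr rfl fun x hx => ?_
    rw [HasAntidiagonal.mem_antidiagonal] at hx
    by_cases ha : x.1 ≤ m
    · by_cases hb : x.2 ≤ n
      · have := (wOK_spec h ha hb).2.1
        have h2 := congrArg (Int.cast : ℤ → ℂ) this
        push_cast at h2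
        have hs : (s : ℂ) + 1 = x.1 + x.2 := by exact_mod_cast hx.symm
        rw [smul_smul, ← add_smul]
        congr 1
        rw [hs]
        linear_combination h2
      · simp [hG.zero x.2 (by omega)]
    · simp [hF.zero x.1 (by omega)]
  rw [← key, Finset.sum_add_distrib, Finset.Nat.sum_antidiagonal_succ, Finset.Nat.sum_antidiagonal_succ']
  simp only [map_sum, Derivation.map_smul, Derivation.leibniz, smul_eq_mul, smul_add, Finset.sum_add_distrib,
    hF.d2, hG.d2, Nat.cast_zero, zero_mul, zero_smul, zero_add, add_zero, Nat.add_sub_cancel]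
  rw [add_comm]
  congr 1
  · refine Finset.sum_congr rfl fun x hx => ?_
    rw [mul_smul_comm, smul_smul, mul_comm (G x.2)]
    congr 1; push_cast; ring
  · refine Finset.sum_congr rfl fun x hx => ?_
    rw [mul_smul_comm, smul_smul]
    congr 1; push_cast; ring

theorem tr_cov {k m n : ℕ} (h : wOK k m n = true) (hk : 1 ≤ k) (hmn : 2 * k ≤ m + n) {d e F G}
    (hF : Cov m d F) (hG : Cov n e G) : Cov (m + n - 2 * k) (d + e) (tr k m n F G) where
  hom l := by
    refine IsHomogeneous.sum _ _ _ fun x _ => ?_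
    rw [smul_eq_C_mul]
    have := (isHomogeneous_C (Fin 8) ((wZ k m n x.1 x.2 : ℤ) : ℂ)).mul ((hF.hom x.1).mul (hG.hom x.2))
    rwa [zero_add] at this
  zero l hl := by
    refine Finset.sum_eq_zero fun x hx => ?_
    rw [HasAntidiagonal.mem_antidiagonal] at hx
    by_cases ha : x.1 ≤ m
    · by_cases hb : x.2 ≤ n
      · rw [(wOK_spec h ha hb).2.2.1 (by omega)]; simp
      · simp [hG.zero x.2 (by omega)]
    · simp [hF.zero x.1 (by omega)]
  d10 := by
    obtain ⟨s, rfl⟩ : ∃ s, k = s + 1 := ⟨k - 1, by omega⟩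
    rw [tr, zero_add, tr_D1 h hF hG]
    rw [Finset.sum_eq_zero, smul_zero]
    intro x hx
    rw [HasAntidiagonal.mem_antidiagonal] at hx
    by_cases ha : x.1 ≤ m
    · by_cases hb : x.2 ≤ n
      · rw [(wOK_spec h ha hb).2.2.2 (by omega)]; simp
      · simp [hG.zero x.2 (by omega)]
    · simp [hF.zero x.1 (by omega)]
  d1 l := by
    rw [tr, show l + 1 + k = (l + k) + 1 by ring, tr_D1 h hF hG, tr]
    congr 1
    push_cast [hmn]; ring
  d2 l := by
    rw [tr, tr_D2 h hF hG, tr, show l + 1 + k = (l + k) + 1 by ring]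
    congr 1
    push_cast; ring

noncomputable abbrev RC := MvPolynomial (Fin 8) ℂ

def CovL (x : ℕ × ℕ) (F : List RC) : Prop :=
  F.length = x.2 + 1 ∧ Cov x.2 x.1 (fun l => F.getD l 0)

theorem list_range_sum {M : Type*} [AddCommMonoid M] (n : ℕ) (f : ℕ → M) :
    ((List.range n).map f).sum = ∑ i ∈ Finset.range n, f i := by
  induction n with
  | zero => simp
  | succ n ih => rw [List.range_succ, Finset.sum_range_succ, List.map_append, List.sum_append, ih]; simp

theorem trans_cov {k : ℕ} {x y : ℕ × ℕ} {F G : List RC} (h : wOK k x.2 y.2 = true) (hk : 1 ≤ k)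
    (hmn : 2 * k ≤ x.2 + y.2) (hl : x.2 + y.2 < 16 + k - 1) (hF : CovL x F) (hG : CovL y G) :
    CovL (x.1 + y.1, x.2 + y.2 - 2 * k) (trans (ringOps RC) k F G) := by
  obtain ⟨lF, hF⟩ := hF
  obtain ⟨lG, hG⟩ := hG
  have hc := tr_cov h hk hmn hF hG
  refine ⟨by simp [trans, lF, lG]; omega, ?_⟩
  convert hc using 1
  funext l
  by_cases hlt : l < x.2 + y.2 + 1 - 2 * k
  · rw [List.getD_eq_getElem _ _ (by simp [trans, lF, lG]; omega)]
    simp only [trans, List.getElem_map, List.getElem_range, trList, lF, lG, Nat.add_sub_cancel]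
    rw [List.take_of_length_le (by simp; omega)]
    simp only [ringOps, List.map_map, tr]
    rw [Finset.Nat.sum_antidiagonal_eq_sum_range_succ_mk, ← list_range_sum]
    congr 1
    refine List.map_congr_left fun j _ => ?_
    simp only [Function.comp, wZ, smul_eq_C_mul]
    rw [show (((wP k x.2 y.2 j (l + k - j) : ℤ) - wN k x.2 y.2 j (l + k - j) : ℤ) : ℂ) =
      (wP k x.2 y.2 j (l + k - j) : ℂ) - wN k x.2 y.2 j (l + k - j) by push_cast; rfl, map_sub, map_natCast, map_natCast]
    ring
  · rw [List.getD_eq_default _ _ (by simp [trans, lF, lG]; omega)]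
    exact (hc.zero l (by omega)).symm

def meta1 : List (ℕ × ℕ × ℕ) → List (ℕ × ℕ) → List (ℕ × ℕ)
  | [], st => st
  | i :: is, st => meta1 is (((st.getD i.1 (0, 0)).1 + (st.getD i.2.1 (0, 0)).1,
      (st.getD i.1 (0, 0)).2 + (st.getD i.2.1 (0, 0)).2 - 2 * i.2.2) :: st)

def chk : List (ℕ × ℕ × ℕ) → List (ℕ × ℕ) → Bool
  | [], _ => true
  | i :: is, st => decide (i.1 < st.length) && decide (i.2.1 < st.length) && decide (1 ≤ i.2.2) &&
      decide (2 * i.2.2 ≤ (st.getD i.1 (0, 0)).2 + (st.getD i.2.1 (0, 0)).2) &&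
      decide ((st.getD i.1 (0, 0)).2 + (st.getD i.2.1 (0, 0)).2 < 16 + i.2.2 - 1) &&
      wOK i.2.2 (st.getD i.1 (0, 0)).2 (st.getD i.2.1 (0, 0)).2 &&
      chk is (((st.getD i.1 (0, 0)).1 + (st.getD i.2.1 (0, 0)).1,
      (st.getD i.1 (0, 0)).2 + (st.getD i.2.1 (0, 0)).2 - 2 * i.2.2) :: st)

theorem getD_rel2 {α β : Type*} {r : α → β → Prop} {z : α} {z' : β} {L : List α} {L' : List β}
    (h : List.Forall₂ r L L') (j : ℕ) (hj : j < L.length) : r (L.getD j z) (L'.getD j z') := by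
  induction h generalizing j with
  | nil => simp at hj
  | cons h _ ih =>
    cases j with
    | zero => simpa using h
    | succ j => simpa using ih j (by simpa using hj)

theorem run_cov (is : List (ℕ × ℕ × ℕ)) : ∀ {st st'}, List.Forall₂ CovL st st' → chk is st = true →
    List.Forall₂ CovL (meta1 is st) (run (ringOps RC) is st') := by
  induction is with
  | nil => intro st st' h _; exact h
  | cons i is ih =>
    intro st st' h hc
    simp only [chk, Bool.and_eq_true, decide_eq_true_eq] at hc
    obtain ⟨⟨⟨⟨⟨⟨h1, h2⟩, h3⟩, h4⟩, h5⟩, h6⟩, h7⟩ := hc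
    exact ih (.cons (trans_cov h6 h3 h4 h5 (getD_rel2 h _ h1) (getD_rel2 h _ h2)) h) h7

def instrs : List (ℕ × ℕ × ℕ) := [(0, 0, 6), (1, 1, 4), (0, 1, 2), (1, 1, 4), (2, 4, 5), (2, 4, 2), (2, 5, 2), (3, 5, 4), (5, 2, 2), (6, 2, 2),
  (7, 2, 2), (7, 3, 2), (8, 0, 2), (8, 12, 2), (9, 11, 3), (0, 14, 1), (2, 10, 1), (3, 10, 1), (17, 12, 1), (18,
  12, 1), (19, 12, 1), (20, 9, 1), (14, 10, 1), (22, 22, 2), (23, 18, 2), (24, 18, 2), (25, 18, 2), (26, 18, 2),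
  (27, 18, 2), (28, 18, 2), (29, 18, 2), (23, 23, 2), (18, 17, 1), (14, 26, 2), (15, 26, 2), (15, 27, 2), (22,
  20, 1), (36, 24, 2), (24, 21, 1), (20, 30, 2), (21, 30, 2), (22, 30, 2), (23, 30, 2), (23, 32, 2), (24, 32,
  2), (24, 33, 2), (31, 29, 1), (32, 29, 1), (40, 35, 2), (29, 36, 2), (29, 37, 2), (29, 38, 2), (29, 39, 2)]

/-- initial state -/
def base {R : Type*} [CommRing R] (x : Fin 8 → R) : List R :=
  List.ofFn fun i : Fin 8 => ((Nat.choose 7 i : ℕ) : R) * x i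

theorem c2 : (C 2 : RC) = 2 := map_ofNat C 2
theorem c3 : (C 3 : RC) = 3 := map_ofNat C 3
theorem c4 : (C 4 : RC) = 4 := map_ofNat C 4
theorem c5 : (C 5 : RC) = 5 := map_ofNat C 5
theorem c6 : (C 6 : RC) = 6 := map_ofNat C 6
theorem c7 : (C 7 : RC) = 7 := map_ofNat C 7

theorem base_cov : CovL (1, 7) (base (X : Fin 8 → RC)) := by
  refine ⟨by simp [base], ?_, ?_, ?_, ?_, ?_⟩
  · intro l
    by_cases hl : l < 8
    · simp only [base, List.getD_eq_getElem?_getD, List.getElem?_ofFn, hl, dite_true, Option.getD_some]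
      simpa using (isHomogeneous_C (Fin 8) ((Nat.choose 7 l : ℕ) : ℂ)).mul (isHomogeneous_X ℂ (⟨l, hl⟩ : Fin 8))
    · rw [List.getD_eq_default _ _ (by simp [base]; omega)]
      exact isHomogeneous_zero _ _ _
  · intro l hl
    exact List.getD_eq_default _ _ (by simp [base]; simpa using Nat.succ_le_of_lt hl)
  · simp [base, D1, mkDerivation_X]
  · intro l
    by_cases hl : l < 8
    · interval_cases l <;>
        simp [base, D1, mkDerivation_X, Derivation.leibniz, smul_eq_C_mul, Nat.choose] <;>
        (try rw [c7]) <;> (try rw [c2]) <;> (try rw [c3]) <;> (try rw [c4]) <;> (try rw [c5]) <;> (try rw [c6]) <;> ring_nf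
    · rw [List.getD_eq_default _ _ (by simp [base]; omega), List.getD_eq_default _ _ (by simp [base]; omega)]
      simp
  · intro l
    by_cases hl : l < 8
    · interval_cases l <;>
        simp [base, D2, mkDerivation_X, Derivation.leibniz, smul_eq_C_mul, Nat.choose] <;>
        (try rw [c7]) <;> (try rw [c2]) <;> (try rw [c3]) <;> (try rw [c4]) <;> (try rw [c5]) <;> (try rw [c6]) <;> ring_nf
    · rw [List.getD_eq_default _ _ (by simp [base]; omega), List.getD_eq_default _ _ (by simp [base]; omega)]
      simp

theorem chk_ok : chk instrs [(1, 7)] = true := by decide +kernel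

def gen {R : Type*} [CommRing R] (x : Fin 8 → R) (j : Fin 30) : R :=
  ((run (ringOps R) instrs [base x]).getD (29 - j) []).getD 0 0

theorem meta_ok : ∀ j : Fin 30, (meta1 instrs [(1, 7)]).getD (29 - j) (0, 0) = (degs j, 0) := by decide +kernel

theorem gen_cov (j : Fin 30) : gen (X : Fin 8 → RC) j ∈ Inv (degs j) := by
  have h := run_cov instrs (.cons base_cov .nil) chk_ok
  have h2 := getD_rel2 (z := (0, 0)) (z' := []) h (29 - j) (by
    have : (meta1 instrs [(1, 7)]).length = 54 := by decide +kernel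
    omega)
  rw [meta_ok] at h2
  obtain ⟨_, h3⟩ := h2
  rw [mem_Inv]
  refine ⟨h3.hom 0, h3.d10, ?_⟩
  have := h3.d2 0
  rw [h3.zero 1 (by norm_num), smul_zero] at this
  exact this

theorem gen_map {R R' : Type*} [CommRing R] [CommRing R'] (f : R →+* R') (x : Fin 8 → R) (j : Fin 30) :
    f (gen x j) = gen (fun i => f (x i)) j := by
  have hb : List.Forall₂ (fun a b => f a = b) (base x) (base fun i => f (x i)) := by
    simp only [base, List.ofFn_eq_map]
    exact map_rel _ _ (fun i => by simp) _
  have h := run_rel (ringOps R) (ringOps R') (ρ := fun a b => f a = b) (by simp [ringOps])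
    (fun L L' _ h => ringOps_lin_rel f L L' h) instrs (.cons hb .nil)
  exact getD_rel (by simp) (getD_rel .nil h (29 - j)) 0

end Sept


namespace Sept

section P5
variable {E : Type*} [CommRing E]

def PP5 (n : ℕ) (u v : MvPolynomial (Fin 5) E) : Prop :=
  u - v ∈ idealOfVars (Fin 5) E ^ (n + 1) ∧ v ∈ idealOfVars (Fin 5) E ^ n

theorem PP5.mul {n n' : ℕ} {u v u' v' : MvPolynomial (Fin 5) E} (h : PP5 n u v) (h' : PP5 n' u' v') :
    PP5 (n + n') (u * u') (v * v') := by
  have hu' : u' ∈ idealOfVars (Fin 5) E ^ n' := by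
    have := Ideal.add_mem _ (Ideal.pow_le_pow_right (Nat.le_succ n') h'.1) h'.2
    simpa using this
  refine ⟨?_, by rw [pow_add]; exact Ideal.mul_mem_mul h.2 h'.2⟩
  have : u * u' - v * v' = (u - v) * u' + v * (u' - v') := by ring
  rw [this]
  refine Ideal.add_mem _ ?_ ?_
  · rw [show n + n' + 1 = (n + 1) + n' by ring, pow_add]; exact Ideal.mul_mem_mul h.1 hu'
  · rw [show n + n' + 1 = n + (n' + 1) by ring, pow_add]; exact Ideal.mul_mem_mul h.2 h'.1

theorem PP5.one : PP5 0 (1 : MvPolynomial (Fin 5) E) 1 := ⟨by simp, by simp⟩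

theorem PP5.pow {u v : MvPolynomial (Fin 5) E} (h : PP5 1 u v) (k : ℕ) : PP5 k (u ^ k) (v ^ k) := by
  induction k with
  | zero => simpa using PP5.one
  | succ k ih => rw [pow_succ, pow_succ]; exact ih.mul h

theorem PP5.prod {u v : Fin 5 → MvPolynomial (Fin 5) E} (h : ∀ m, PP5 1 (u m) (v m)) (b : Fin 5 →₀ ℕ) :
    PP5 (∑ m, b m) (∏ m, u m ^ b m) (∏ m, v m ^ b m) := by
  induction (univ : Finset (Fin 5)) using Finset.induction_on with
  | empty => simpa using PP5.one
  | insert a s ha ih =>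
    rw [Finset.sum_insert ha, Finset.prod_insert ha, Finset.prod_insert ha]
    exact ((h a).pow _).mul ih

theorem coeff_single_pderiv (l : Fin 5) (P : MvPolynomial (Fin 5) E) :
    constantCoeff (pderiv l P) = coeff (Finsupp.single l 1) P := by
  induction P using MvPolynomial.induction_on' with
  | add p q hp hq => simp [hp, hq]
  | monomial u a =>
    rw [pderiv_monomial, constantCoeff_monomial, coeff_monomial]
    by_cases h : u = Finsupp.single l 1
    · subst h; simp
    · rw [if_neg h]
      split_ifs with h2
      · have : u l = 0 := by
          by_contra h3
          apply h
          ext j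
          have := DFunLike.congr_fun h2 j
          simp only [Finsupp.coe_tsub, Pi.sub_apply, Finsupp.coe_zero, Pi.zero_apply] at this
          by_cases hj : l = j
          · subst hj; simp at this ⊢; omega
          · simp [hj] at this ⊢; exact this
        simp [this]
      · rfl

theorem PP5.of_coeff {P : MvPolynomial (Fin 5) E} {m : Fin 5} (h0 : constantCoeff P = 0)
    (h : ∀ l, constantCoeff (pderiv l P) = if m = l then 1 else 0) : PP5 1 P (X m) := by
  constructor
  · rw [mem_pow_idealOfVars_iff']
    intro x hx
    rw [coeff_sub, sub_eq_zero]
    have hx1 : x.degree ≤ 1 := by omega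
    rw [Finsupp.degree_eq_sum] at hx1
    by_cases hx0 : x = 0
    · subst hx0
      rw [← constantCoeff_eq, h0]; simp
    · obtain ⟨l, hl⟩ : ∃ l, x l ≠ 0 := by
        by_contra hc
        push Not at hc
        exact hx0 (Finsupp.ext hc)
      have hxl : x = Finsupp.single l 1 := by
        ext j
        by_cases hj : l = j
        · subst hj
          have := Finset.single_le_sum (f := fun j => x j) (fun _ _ => Nat.zero_le _) (mem_univ l)
          simp at this ⊢; omega
        · have := Finset.add_le_sum (f := fun j => x j) (fun _ _ => Nat.zero_le _) (mem_univ l) (mem_univ j) hj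
          simp [hj]
          omega
      rw [hxl, ← coeff_single_pderiv, h, coeff_X]
      simp [Finsupp.single_left_inj]
  · rw [pow_one]
    exact Ideal.subset_span ⟨m, rfl⟩

theorem PP5.zero (h : MvPolynomial (Fin 5) E) : PP5 0 h (C (constantCoeff h)) := by
  refine ⟨?_, by simp⟩
  rw [mem_pow_idealOfVars_iff']
  intro x hx
  have : x = 0 := by
    rw [← Finsupp.degree_eq_zero_iff]; omega
  subst this
  simp [constantCoeff_eq]

theorem prodX (β : Fin 5 →₀ ℕ) : (∏ m, X m ^ β m : MvPolynomial (Fin 5) E) = monomial β 1 := by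
  rw [monomial_eq, C_1, one_mul, Finsupp.prod_fintype]
  simp

theorem coeff_core {K : Type*} [CommRing K] [Algebra K E] {u : Fin 5 → MvPolynomial (Fin 5) E}
    (hu : ∀ m, PP5 1 (u m) (X m)) (h : MvPolynomial (Fin 5) E) (b : MvPolynomial (Fin 5) K)
    (a : Fin 5 →₀ ℕ) (hb : ∀ β, β.degree < a.degree → coeff β b = 0) :
    coeff a (aeval u b * h) = coeff a b • constantCoeff h := by
  rw [aeval_def, eval₂_eq', Finset.sum_mul, coeff_sum]
  have key : ∀ β ∈ b.support, coeff a (algebraMap K (MvPolynomial (Fin 5) E) (coeff β b) * (∏ i, u i ^ β i) * h) =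
      if β = a then coeff a b • constantCoeff h else 0 := by
    intro β hβ
    have hd : a.degree ≤ β.degree := by
      by_contra hc
      exact (mem_support_iff.mp hβ) (hb β (by omega))
    have h1 := ((PP5.prod hu β).mul (PP5.zero h)).1
    rw [← Finsupp.degree_eq_sum, add_zero, mem_pow_idealOfVars_iff'] at h1
    have h2 := h1 a (by omega)
    rw [coeff_sub, sub_eq_zero, prodX, mul_comm _ (C _), C_mul_monomial, coeff_monomial] at h2
    rw [mul_assoc, ← Algebra.smul_def, coeff_smul, h2]
    split_ifs with hh
    · subst hh; simp
    · simp
  rw [Finset.sum_congr rfl key, Finset.sum_ite_eq']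
  split_ifs with hs
  · rfl
  · rw [notMem_support_iff.mp hs, zero_smul]

theorem core_indep {K : Type*} [Field K] [Algebra K E] {ι : Type*} [Fintype ι]
    {u : Fin 5 → MvPolynomial (Fin 5) E} (hu : ∀ m, PP5 1 (u m) (X m)) (h : ι → MvPolynomial (Fin 5) E)
    (hh : LinearIndependent K fun i => constantCoeff (h i)) (b : ι → MvPolynomial (Fin 5) K)
    (hs : ∑ i, aeval u (b i) * h i = 0) (i : ι) : b i = 0 := by
  have key : ∀ n, ∀ a : Fin 5 →₀ ℕ, a.degree = n → ∀ i, coeff a (b i) = 0 := by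
    intro n
    induction n using Nat.strong_induction_on with
    | _ n ih =>
      intro a ha i
      have h1 := congrArg (coeff a) hs
      rw [coeff_sum, coeff_zero] at h1
      rw [Finset.sum_congr rfl fun i _ => coeff_core hu (h i) (b i) a
        (fun β hβ => ih β.degree (by omega) β rfl i)] at h1
      exact (Fintype.linearIndependent_iff.mp hh) _ h1 i
  ext a
  simpa using key _ a rfl i

theorem main_indep {K : Type*} [Field K] [Algebra K E] {ι : Type*} [Fintype ι] {P : Type*} [CommRing P] [Algebra K P]
    (φ : P →ₐ[K] MvPolynomial (Fin 5) E) (θ : Fin 5 → P) (η : ι → P) (c : Fin 5 → K)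
    (h0 : ∀ m, constantCoeff (φ (θ m)) = algebraMap K E (c m))
    (h1 : ∀ m l, constantCoeff (pderiv l (φ (θ m))) = if m = l then 1 else 0)
    (hh : LinearIndependent K fun i => constantCoeff (φ (η i))) (a : ι → MvPolynomial (Fin 5) K)
    (hs : ∑ i, aeval θ (a i) * η i = 0) (i : ι) : a i = 0 := by
  let u : Fin 5 → MvPolynomial (Fin 5) E := fun m => φ (θ m) - C (algebraMap K E (c m))
  have hu : ∀ m, PP5 1 (u m) (X m) := fun m => PP5.of_coeff (by simp [u, h0]) (fun l => by simp [u, h1])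
  let σ : MvPolynomial (Fin 5) K →ₐ[K] MvPolynomial (Fin 5) K := aeval fun m => X m + C (c m)
  let τ : MvPolynomial (Fin 5) K →ₐ[K] MvPolynomial (Fin 5) K := aeval fun m => X m - C (c m)
  have hτσ : ∀ q, τ (σ q) = q := by
    intro q
    have : τ.comp σ = AlgHom.id K _ := by
      ext m; simp [τ, σ]
    exact DFunLike.congr_fun this q
  have hσ : ∀ q, aeval u (σ q) = φ (aeval θ q) := by
    intro q
    have : (aeval u).comp σ = φ.comp (aeval θ) := by
      apply MvPolynomial.algHom_ext
      intro m; simp [σ, u]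
    exact DFunLike.congr_fun this q
  have h3 := core_indep hu (fun i => φ (η i)) hh (fun i => σ (a i)) (by
    have := congrArg φ hs
    rw [map_sum, map_zero] at this
    rw [← this]
    refine Finset.sum_congr rfl fun i _ => ?_
    rw [map_mul, hσ]) i
  rw [← hτσ (a i)]
  rw [h3, map_zero]

end P5
end Sept


namespace Sept

def mmD : ℕ := 0x41381e1cbe568781895bab6537315e6a67c400cc4a82999761b99f9aa31e1e4f3069ea4b46647d719fb943b6
def xD : List ℕ := [
  0x709c5047828ca4295ae3501f85d8f1386d44381fa8e461362588b28ebf7ce7db70e9e779cc4c0ad24f6881cd,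
  0xaab01036bf61e5b7c0218d04203f995d73a8ad7fc366eaf4e423961388501a4d50405b91b7182cd6bcc863f8,
  0xec18d54ec2c328c17d5c4c9a51e1417f421d44e04624ce3a385b75104ddb7455a92469293b14d7aada994143,
  0x2c17812489eeb95a8090616acf68fa6b0463b0b13e00b828c2420b23ec550c6137882173ecf7a14ef84ac0f3,
  0xb2d419870136882cb5cdd4437969549470a744169cd25cb1d13c6aa202eb9a7e2b078dec87faeeea8931d70e,
  0x2ef15aa376c2dab524a93581be840a10d8aaf4ba9b5b42cc4b8a9cdaaa1cf3d27eb5cb8c8ba50355adb1d594,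
  0x250f73585728d238815f5e5e4c5ea250c56b2b131786c7da3f45bb431f1cc308355b56eedfc5493ce6c99687,
  0x28578e796587fa01dde82ea2cec22f1edfb11dc4534dbfb4859c360587cf77c48f2376df685ef4d8b230a28d]
def uD0 : List ℕ := [
  0x40050b7c480a4a7d7e3463da1d015b46c701bee3ec31d588425b55b09962613fea97be7ad3d3c146b840b0f4,
  0x8639c582300e9b996f0a07320740d2f33cf4f1536e07ac7385c1b1ef03f1d69cbf862dabba012b0704c493b1,
  0xccde492a2ef0902f5805a998169d3964f5f520b923985bb131311ccaa03d39f579735a510e0a6d7ffa8c155d,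
  0xdc54d0d3bcec0439e1039f8a5e127a600e4adac40e77844806f5eaab3af1d572805b37a606d90519cd6ef2b6,
  0xb60a00d6b4422d89dd2931b874720deacc3755e1c158381636bb3fd9583cd0cead33e7258967e11fae7dee84,
  0x0,
  0x0,
  0x0]
def uD1 : List ℕ := [
  0xdf914862f01b7e2c6a34c3300983cce39d6b31bed90958280867cf803114462f8cc7335a7bc09b0dc1b0a8f9,
  0x3c16e2037635e3cc3bcbf85fdbca50020ae32f52003a53d82c3dcf726ce73ec28f28acdf82cbce761a3f3f48,
  0x2d9e7319277665e29f4fbbc98f3cd271963490f7d83a2632248e0a81258f0174405f37217fa843821a1e2077,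
  0x636f0bda6af1caa39f818868eb57d056b6b3f5b0d1010f4ef2dd864d196d0afa51d0e1c42fcdb89b0218c2d0,
  0xeb528f4ede4fea645035bcf3bd0c3debe15263f745debd151f70efca14ae9ba102cea268165f4ecfce7aba9f,
  0x0,
  0x0,
  0x0]
def uD2 : List ℕ := [
  0x177d20c8d0443b9f663196cfcf917b5ced09ef52dfc221ee6340f928ddaea6282d4e2d8bb18baa4953cce006,
  0x2a00c923646fdc4770552e11e9b3219134128e112ff87c955de99c8242c079648b77edc95ec5e4cb23b55082,
  0x9bdebc55baa729146dad37b56bdd52ce08181255618a06c091da78eb267b7e24a437f4cded7cc7644260af24,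
  0xe1e774849b63cd869dddae77f2e381c28a1a87240fba2ba2a891cd008cef7fa164c323a82712603fc74ae480,
  0xd08f6011891af6e6b2f83bab6b7a05c49151dd8f5df746316f126ef66c3fcdfaa69f4b943bed955fa345a4ce,
  0x0,
  0x0,
  0x0]
def uD3 : List ℕ := [
  0xf081191b5cedacebca1a69b608ad79030cebe3343770b750e44e5f05557a71a485f20a3112caccbe9f234023,
  0xa241d2808a3f459b4f35b174db4e057541c47cc9493101c813100b66f292be8a7962a5a32bc92b454422f4ec,
  0x30e5410538ca5bdc89f85d1ad4299ea91200b0068d9939024d7783e01febe09aef663d139046b8772771c7ab,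
  0xcccfab60bc3718ed909307645485cdb5ee300525218b2d3bf54e3a382f4401704f08bf6b27c0f91e9f43da39,
  0xc1063db660aff097926e9fc9caa78ccd9f8ecca680eaa31fbcb7d964ca2c44012840e49a6eb198a9f87f1c7d,
  0x0,
  0x0,
  0x0]
def uD4 : List ℕ := [
  0xa881a7d737087a35f81fa781497ff05491c7549e7d6fbb5b6dd3156d2c47374992530e2eaac47f826e7641ac,
  0x4669c3cd747dcec38ba40a1f011e17e684796149510087a7d00fbb3d0fa039d0bd0457e2d938f5492e0cbc78,
  0xb71e3b93da6aa2aa6c33a8e997a0ef6471d49185756639773e9d77a9c372d498973f09b204711f688b4c7470,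
  0xd1b744f5a4aaa32ca122ec57d21cc59a1c81d652740a12634e41e4bf56da0d606cf0c788cbcaa5295b923751,
  0xb235816e57b7842a6ccdd26fad8201225cbc813dc56c23685915506a2a0dd53222eb6a80ae8af46846c0f576,
  0x0,
  0x0,
  0x0]
def cD : List ℕ := [1, 93, 21, 210, 72]
def ceD : List ℕ := [
  0x1,
  0x100,
  0x1000000000000000000,
  0x6c6f6b8b004e0000d10149d5664820a239f9c857267ec25c6e,
  0x899970ad6fa5a58792eb51e3bd663b0216005acd2dc2ac7b81482dbfa171c9402fe41b13,
  0x64d903503e1ee836b2a28e5499f4b56c261c9bbbae60c684d04203bca30fdd3ad4a5484b4d399a019bc5a6,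
  0x772bce8307188bdd35135474dd0331e1649cab383599ba0ce2e70dbf8e1c1f799ef31c50538ad0202e17f18,
  0x873b4ef3d6aca8f9dda03e3db2270f30dd9639c75a3ad13f3b705b398f319bb2b52bd16d73500e72f9714f39,
  0x21aa2b3ef5b2064f6d817c45edc6a4d70970da3b664fe9b7f81b154e5dc333fa383d41d4278778d983c49f21,
  0x6fa7d9a20dd946a59b107e9b0fc5e1307c987d3c231c0d2e46c003e85e796b8fd8a5d6be6d0a976b3add3cc6,
  0x633f3f9c0962bcdd410cb3a6b81f0f5f0401cef57dd288dc054a222af7311f01a876dd351b890da385c393f4,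
  0x96ed707ad3c38c7ac53fca6af88b28508dcb7e936e3af8b7bae63cb2d51343a06c3e3b592502457c9ef55d4e,
  0x1c5a4a975a727ae9745138e22a391c561d0dc9d3dceae975a15d1e16ba09412d826c5392e88e101c7418cb4c,
  0x2149cc1103a8df7a53c4999725eb1981b81b01a2ea02020fe69f1d2c1085101a7983324726d85a22f4d7db07,
  0x1431cdae9ad7fa3148d091ccd5cb2ac31a8cb05e483015288e0c120847729533e4ca6f9688373085dcd985e4,
  0x17c94fa130af4af638d5d0a9ce7e330bfaed849badba0b9ff4513344cdc58bb29454f5401971ecf173a38607,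
  0x4fdab3b9bea230358a6d8a64c018176069349d117b8d3ea200f083c28bcb72f0675b1854a978863b10dee54d,
  0x563b13a8a74fd848c8c4cc31c5cd450bd0c58a21f18afa8facafc7a176a54e77cb8e08e36cb39e76891231f3,
  0x9b994e75e824bfed7c663e7c598a1f1ebe1dd70edd01a9b18d56bcac17d4700111d28603c3d66ebfb6e3c348,
  0x47e7857d860cda8a2488ecaab0c72543807bd0ae064e7b806b852e0e938b0ecf77b4db77a64845a08841285f,
  0x6ebdbf2adb4cf24c5457a20d1acb4982ae16170f1cba6fe8684a535adf1fb0d69548d882e66bc88695e9e3ab,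
  0x3df537610cab7a14c30635927f5298a413a2f448d593c3d05b1d56b926ba1547a0f86f53014482d7ad9feeef,
  0x35a8aaadda681293cb570b449ce258f7fa88f94230d4e078a9dd4a8b295b1e8ed79283f4a1baae8b4d17faea,
  0x16077ad767bf929cea8f1f56258c09526727c88ef9c262c9ecb5fa3992ccc4dd0b798b262194955c7263f3c1,
  0xedca208de76a365f1e5233c76b71c334c0834c1939708526f57f61856a401d69c22bd0c25a526a71671d983f,
  0xd47d30a36f57f4e7e5e6888803311473c8f7a5f71488ca4c35973d4abe922619d6654a023c6c1bd12bd4cc57,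
  0x779443c57fb3093d8ddb7c96b395c3d1308d24d6df503a06df34df86b385363492862fcd68f21cace6e387cc,
  0x14559b7017e81fcf72a7a891669d7c290b1cf76d056b5c5431863bf1d8707bb272acd40551587572b68d1864,
  0x742a0dea1d0f61f38b7446e09a41a2edaa7ee076ed8733ef427026c56485a72168700fe8bfa12097482d6cab,
  0x5445044d3686d10610454d28159acd7711423ca8837fbbf1a0a1cc7f471d2a7838623580eb8553d15d7858d4,
  0x69189333095ac8b4de33c90ad849c5f5c127b88894010ea2be8742e9784f38ca0de742233ae55d3ce69d80a8,
  0x473c41cf138e0777b7482ff8d0dada10de6721596d8c093f1e150981188c1dc0c19e6283bcda02c5435ab5b5,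
  0xe084b34e575fdc04aa84ce827623d80f5d347ea0b71f709430e5ede0d22abceb40cd39d8849eac409601abaa,
  0x1221e11f348283ae49d9118ab8233ecabdf2c88aa1ddc303707381ccd2763787c6df8cadb3f57a4dc491f5c9,
  0x65de6c854ffa9be2ea72b4ba23ea4bf374dea1b485d61b2610703adc57df85a2e0fa7d354ecc4fd2909c6ec4,
  0xe4d19890bff23b1a2c90e297916562dd04f54f875f54bb9ced5953661febb899b2e363711cc4fa83681c0ccd,
  0xa495b6a4df595d2ecd53dcf4927b1ff17697abf6b39a3961254bd74e7c7c278e65402aeef7db1d695adb8ff2,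
  0xcb8f71be8e0ccb1e5b15d41b7fd2230a60e2bbe35fe42cf312d6411e322b372c00cfb1dc12d73e10d11ad117,
  0x5038e1954ba9398154c562f6d592ec2b1b804f7f0833d981fa6f9fa499329007a62e4214126ec2e79c47e37e,
  0x9e5a7cef91a103dda91a1a09f07d59a6f281bd289d666046a290af5f60f67954117c88e2157b3a09354bd2b6,
  0xceda00c69ddaa944d48f0530e0fa5d8481deded0a008623f54e039a0e2a2204c5d7af8f3cf5f7e22940a6f15,
  0xcdd70807893c94cfa3a13ce3ab471ce198b4ca4b6b01317bc74508c602f41954907cfabd2003adfaa087d735,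
  0xdf129c9ee416d754a54acfc24666c1aae5475df63ff8bf5f726ca4c5aee383092a5f8022d8fa0857915ca8d4,
  0xe938f939175bc405b271963f0ed1a83782f99049670a803f8929c542f47e40c588d5fd3bd2acb9dd5466302]
def coD : List ℕ := [
  0x9a4b4db4480ed369cdaab6c9528306b0aca8800fa99e7479c8c26980e45eb263f5e7b46f2368ebc54e1c6509,
  0x10a5bcbf094edfb08bc8f567d3b8d6ec8722a837826b1dbb45c3f11763429de38dbdd4c7cf814b4d1d19e79e,
  0x4e1b6d126b00f133bc8ac063d98b29e666aa2f8610d3ede437c72d3673c76b3f8f11a040434880012a562cac,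
  0x5528b7055b52ae2088bce5be5dbd852cdfe1550b0edc2231016a81daef45896cd8b97282249d26b2c301d7b8,
  0x2f35372de4df8d683023e209006d4b1f36c5dcbe11f36ced9b0c88f45d857c3b742c4e52aeb20d6e74d283fa,
  0x9c8b7448594abe9d514252f215267ec16c07e0e33eb0e653bbe9218d0b4780ab7133dcee5a5886af3743185d,
  0xa49ad22c1ae74fa5866652936a53dec739aa373ab2e05055d4282470de93764b122b5f1f14990c52a48ef5dc,
  0x64a68bd6ceb2b14f91295746e3bcc3c4aec23b9d844a7d93ce8f2e6332c377899836279508d0d596d24ec87f,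
  0x3dbd63f6873fb6011f045558028919578b95f1ebeba9cb911faa5f6f64a88542648e929b94ea3f5430076966,
  0x40ebc7d753af0a81844ba9a73c4d954e6c550d9acaa03f724deacbbd3944835ea155ed1810686e069bbd02c,
  0x954bb7a26a288c733242be52f14e5a59ebf3dc42448dab0c3cdd052ee884cc03f9c08628cc8e9f54828dfa09,
  0x2b2cf6a03c0f1e2a9cade66c35691316ec92905ec694450d72c514d6e6d0cdf73aa2a20baf7502d7a3f98c5,
  0xa4f702bdfa0eafe4843921743ec3a48f7fabe98dc2a1a9e7a58dc36ee9c34f6cf7442735024149aaadeb7ad9,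
  0xc1ed8b6170649b5ae2ce26ad2607b0d4d743da134a1cfa5f150517b7530b0fa6027da00fac4fb3e3390926be,
  0x68514dcac12ab05373af02954c7220ebc69fb29bd940c15c53a69891e5915c13126e567f3da19b2752f69287,
  0x5066ac795ed75201774d31ca650a5a7695f8595df2b8752cd29e7c9ed0a296c05021540cab6c62fdf7e56f7,
  0xcf65c82d38615780902707bce712caf29ec3cebcf2230cc45bcc3bd9e1da3772d3b6ca85b81180f4b925c2ce,
  0xa5606023e897b6ec821d39bd75bd250ec9f6e952e7ee69ed5b299ea643c0b44a6e39281bbc44dddc961ab4d2,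
  0x8145b6387a8ffad35a78c537cf4cfa13e3304a856944e5601ff1a433c5810dc4d3f2892e08c9cb597b8f06a2,
  0x7a4e8090d6e852932b2bef82f87e18a1e50671aa47c9507bcd113a32b747aa8a66b26d9faa70d12c942dd4c3,
  0x7349dada1889a80b064f25b1f75fdb5e9524c63322d24c7338098ac8fa944240822eaf53bd46608b39b486b9,
  0xe1636b8bbb0a7d3f0d8c529bf506ccd205cd5852f3a3e86ddeac19356f5e0918e530a12896504d211abede7f,
  0x373a233e42175bdd817e4170e37403a6d9baf7e8dfe18259999cbd42956e85971682e9c32ca9edb2e3bbf3f9,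
  0xbb722832682ba0565d9e111e6c9c664a9ff9805df77775b9e1f896b053987aea09a78985911b06e751106951,
  0x45060e75a72e46510c0e7e04c76dc845b93d0dbebd8f71a21f06f2c4c5a1ad2e54f9b7c3556f52e92a340715,
  0x9307515249af921e7c236dd917838800a5d090e2e057e2d3fa00c5ef6bd55f202c0f1ef61938bd233972738a,
  0xeae994402f3906d372c654c0d625849d383ee0573f710f89119ffa8b5197181072b2c281c773055889c66150,
  0x62985a6da5e3ba6318060570a3c4f34b5b3af799a7abf0d4436e7bbc71e06d3f74621c5bca860809f9d8d03,
  0x72b7033e0d239c14dd14c5a95b3b4286f0873aeca2c5c3a0461b3274e4f2235441d1ac506a44a41b274f7737,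
  0xd83ecd4c1b980709687e7616527bd5beca9649eb1c1638505fbdc215138fb54aefb08b4fba633852e882a999,
  0xd4845f74d0c18502c01e661fec23589c27e5198e6728609e80a013bfe4a964576aa5c85272c5cf145598c27b,
  0xfad02857c8cddd00a07af9cce75b32c3ec5a26ecf8b3db742988c99163b0005db0b549bd345061e5150ad8b1,
  0xc778d4df78a25edaf26f9fbecef7e9c0b3daec19cd1568f3903e7702d8741d226122856dd28a4dd6dce6b215,
  0x135a8e300705de34451e4d87adc61d1548e4dbdf657e36926585e2456df9c66de885502516b8e7eaf799c105,
  0x2f34cc8501022c36e5e6421772706806a06f9b0804a68170ba4a91eecc10f744f1caa8627b007ebd2f937072,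
  0x742d345ca5f58f2e312ed3f6646f13e090a16a0a148143b2b1b370bfd676f5037e9156b431141df8c4b5548f,
  0x1c488e4a66df21c4376f0d5d727b08533a7b0fdf7ceae73ce66a1713412ced48f9f9db7fe2774340ddac1912,
  0x21d22d2ea83bf7872bd9e228bebe472aaa1430c7437ba35f09537370369f50bc7dbf61f23cbc23963e51026a,
  0xeb97930aa53ad303d583c93633de87815de32021124fa58395be9902736574ee59a9996ea1d80f4b79689e38,
  0xc8d9c64bf4700a47309c8ee2aebb16e5baf61e41b65b76567ee705b5b8f43b24627b81a2fa4f7670302ba575,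
  0x231c0fd0396d0fd62785228624ea8ec935a449b1cc7250e950d14ae20893df97d6a547add438a0ee6cc382,
  0x57811949db3e17a6b77eda1f56d62424de603d0819d8c8c4b9937b7c1eedd7884d4645f4c2c37067bea8417b,
  0x2b18a181567b5e7fe54ecac25ebdc0e830095f2445986795c9e70f1100858972bebce7c95c6083e579e48675,
  0x33ce17bfcea488f7b655f550882b864ea1768b7d397a96732867c770ebb56356cd2e519d56ae5eafc5c91f03]

def bb : ℕ := 18446744073709551616

def force {β : Type*} (n : ℕ) (f : ℕ → β) : β :=
  match n with
  | 0 => f 0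
  | k + 1 => f (k + 1)

def norm : ℕ → ℕ → ℕ
  | 0, _ => 0
  | k + 1, n => (n % bb) % 251 + bb * force (n / bb) (norm k)

def hi : List ℕ → ℕ → ℕ → ℕ
  | [], _, acc => acc
  | r :: rs, h, acc => force (acc + (h % bb % 251) * r) fun acc' => force (h / bb) fun h' => hi rs h' acc'

def bb44 : ℕ := bb ^ 44
def bb43 : ℕ := bb ^ 43

def red (T : List ℕ) (n : ℕ) : ℕ :=
  force n fun n => norm 44 (hi T (n / bb44) (n % bb44))

def sum1 : List ((ℕ × ℕ) × (ℕ × ℕ) × (ℕ × ℕ)) → ℕ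
  | [] => 0
  | x :: L => ((x.1.1 + 250 * x.1.2) % 251) * (x.2.1.1 * x.2.2.1) + sum1 L

def sum2 : List ((ℕ × ℕ) × (ℕ × ℕ) × (ℕ × ℕ)) → ℕ
  | [] => 0
  | x :: L => ((x.1.1 + 250 * x.1.2) % 251) * (x.2.1.1 * x.2.2.2 + x.2.1.2 * x.2.2.1) + sum2 L

def opsN (T : List ℕ) : Ops (ℕ × ℕ) where
  z := (0, 0)
  lin L := (red T (sum1 L), red T (sum2 L))

def fL {β : Type*} : List (ℕ × ℕ) → (List (ℕ × ℕ) → β) → β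
  | [], k => k []
  | x :: xs, k => force x.1 fun a => force x.2 fun b => fL xs fun ys => k ((a, b) :: ys)

def runK {β : Type*} (T : List ℕ) : List (ℕ × ℕ × ℕ) → List (List (ℕ × ℕ)) → (List (List (ℕ × ℕ)) → β) → β
  | [], st, k => k st
  | i :: is, st, k => fL (trans (opsN T) i.2.2 (st.getD i.1 []) (st.getD i.2.1 [])) fun ys => runK T is (ys :: st) k

/-- unpack from base 256 to base `bb` -/
def up : ℕ → ℕ → ℕ
  | 0, _ => 0
  | k + 1, n => n % 256 + bb * force (n / 256) (up k)

def tblK {β : Type*} (r0 : ℕ) : ℕ → ℕ → (List ℕ → β) → β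
  | 0, _, k => k []
  | j + 1, r, k => force (norm 44 ((r * bb) % bb44 + (r / bb43) * r0)) fun r' => tblK r0 j r' fun T => k (r :: T)

def baseN (x u : List ℕ) : List (ℕ × ℕ) :=
  (List.range 8).map fun i => (norm 44 (Nat.choose 7 i * up 44 (x.getD i 0)), norm 44 (Nat.choose 7 i * up 44 (u.getD i 0)))

def genN (st : List (List (ℕ × ℕ))) (j : ℕ) : ℕ × ℕ := (st.getD (29 - j) []).getD 0 (0, 0)

def thN : List ℕ := [0, 1, 8, 9, 25]

def chkTh (l : ℕ) (st : List (List (ℕ × ℕ))) : Bool :=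
  (List.range 5).all fun m => (genN st (thN.getD m 0)).1 == cD.getD m 0 &&
    (genN st (thN.getD m 0)).2 == if m = l then 1 else 0

def withT {β : Type*} (k : List ℕ → β) : β := force (up 44 mmD) fun r0 => tblK r0 44 r0 k

def uD : List (List ℕ) := [uD0, uD1, uD2, uD3, uD4]

def prodN (T : List ℕ) (st : List (List (ℕ × ℕ))) : List (Fin 30) → ℕ
  | [] => 1
  | a :: l => red T ((genN st a).1 * prodN T st l)

def fN {β : Type*} : List ℕ → (List ℕ → β) → β
  | [], k => k []
  | x :: xs, k => force x fun a => fN xs fun ys => k (a :: ys)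

def dot : ℕ → List ℕ → ℕ
  | _, [] => 0
  | r, a :: l => (r % 256) * a + force (r / 256) fun r' => dot r' l

def chkEta (T : List ℕ) (st : List (List (ℕ × ℕ))) (rows : List ℕ) (et : List (List (Fin 30))) : Bool :=
  fN (et.map (prodN T st)) fun v => (List.range 44).all fun j => norm 44 (dot (rows.getD j 0) v) == bb ^ j

def chkA : Bool :=
  withT fun T => fL (baseN xD (uD.getD 0 [])) fun b => runK T instrs [b] fun st =>
    chkTh 0 st && (chkEta T st ceD etaE && chkEta T st coD etaO)

def chkB (l : ℕ) : Bool :=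
  withT fun T => fL (baseN xD (uD.getD l [])) fun b => runK T instrs [b] (chkTh l)

section rep
variable {E : Type*} [CommRing E] (x : E)

inductive Rep (B : ℕ) : ℕ → ℕ → E → Prop
  | nil : Rep B 0 0 0
  | cons {D a m : ℕ} {e : E} : a ≤ B → Rep B D m e → Rep B (D + 1) (a + bb * m) (a + x * e)

variable {x}

theorem Rep.nil_inv {B n : ℕ} {e : E} (h : Rep x B 0 n e) : n = 0 ∧ e = 0 := by
  cases h; exact ⟨rfl, rfl⟩

theorem Rep.digit {B n : ℕ} {e : E} (h : Rep x B 1 n e) : n ≤ B ∧ e = (n : E) := by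
  cases h with
  | cons ha h =>
    obtain ⟨h1, h2⟩ := h.nil_inv
    subst h1; subst h2
    simpa using ha

theorem Rep.mono {B B' D n : ℕ} {e : E} (h : Rep x B D n e) (hB : B ≤ B') : Rep x B' D n e := by
  induction h with
  | nil => exact .nil
  | cons ha _ ih => exact .cons (ha.trans hB) ih

theorem Rep.zero (B D : ℕ) : Rep x B D 0 0 := by
  induction D with
  | zero => exact .nil
  | succ D ih => simpa using Rep.cons (a := 0) (by omega) ih

theorem Rep.monoD1 {B D n : ℕ} {e : E} (h : Rep x B D n e) : Rep x B (D + 1) n e := by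
  induction h with
  | nil => exact Rep.zero B 1
  | cons ha _ ih => exact .cons ha ih

theorem Rep.monoD {B D D' n : ℕ} {e : E} (h : Rep x B D n e) (hD : D ≤ D') : Rep x B D' n e := by
  induction hD with
  | refl => exact h
  | step _ ih => exact ih.monoD1

theorem Rep.peel {B D n : ℕ} {e : E} (h : Rep x B (D + 1) n e) (hB : B < bb) :
    ∃ e', e = ((n % bb : ℕ) : E) + x * e' ∧ Rep x B D (n / bb) e' ∧ n % bb ≤ B := by
  cases h with
  | cons ha h =>
    rename_i a m e'
    have h1 : (a + bb * m) % bb = a := by rw [Nat.add_mul_mod_self_left, Nat.mod_eq_of_lt (by omega)]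
    have h2 : (a + bb * m) / bb = m := by
      rw [Nat.add_mul_div_left _ _ (by decide), Nat.div_eq_of_lt (by omega), zero_add]
    exact ⟨e', by rw [h1], by rwa [h2], by rwa [h1]⟩

theorem Rep.uniq {B B' D n : ℕ} {e e' : E} (h : Rep x B D n e) (h' : Rep x B' D n e') (hB : B < bb) (hB' : B' < bb) :
    e = e' := by
  induction D generalizing n e e' with
  | zero => cases h; cases h'; rfl
  | succ D ih =>
    obtain ⟨f, h1, h2, -⟩ := h.peel hB
    obtain ⟨f', h1', h2', -⟩ := h'.peel hB'
    rw [h1, h1', ih h2 h2']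

theorem Rep.add {B B' D n n' : ℕ} {e e' : E} (h : Rep x B D n e) (h' : Rep x B' D n' e') :
    Rep x (B + B') D (n + n') (e + e') := by
  induction h generalizing n' e' with
  | nil => obtain ⟨h1, h2⟩ := h'.nil_inv; subst h1; subst h2; simpa using Rep.nil (x := x)
  | cons ha _ ih =>
    cases h' with
    | cons ha' h' =>
      have := Rep.cons (Nat.add_le_add ha ha') (ih h')
      convert this using 1
      · ring
      · push_cast; ring

theorem Rep.smul {B D n : ℕ} {e : E} (h : Rep x B D n e) (c : ℕ) : Rep x (c * B) D (c * n) (c * e) := by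
  induction h with
  | nil => simpa using Rep.nil (x := x)
  | cons ha _ ih =>
    have := Rep.cons (Nat.mul_le_mul_left c ha) ih
    convert this using 1
    · ring
    · push_cast; ring

theorem Rep.smul_le {B D n c C : ℕ} {e : E} (h : Rep x B D n e) (hc : c ≤ C) :
    Rep x (C * B) D (c * n) (c * e) := (h.smul c).mono (Nat.mul_le_mul_right _ hc)

theorem Rep.shift {B D n : ℕ} {e : E} (h : Rep x B D n e) : Rep x B (D + 1) (bb * n) (x * e) := by
  simpa using Rep.cons (a := 0) (by omega) h

theorem Rep.pow (j D : ℕ) (h : j < D) : Rep x 1 D (bb ^ j) (x ^ j) := by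
  induction j generalizing D with
  | zero =>
    obtain ⟨D, rfl⟩ : ∃ D', D = D' + 1 := ⟨D - 1, by omega⟩
    simpa using Rep.cons (a := 1) (le_refl 1) (Rep.zero (x := x) 1 D)
  | succ j ih =>
    obtain ⟨D, rfl⟩ : ∃ D', D = D' + 1 := ⟨D - 1, by omega⟩
    rw [pow_succ', pow_succ']
    exact (ih D (by omega)).shift

theorem Rep.one (D : ℕ) (h : 0 < D) : Rep x 1 D 1 1 := by simpa using Rep.pow (x := x) 0 D h

theorem Rep.mul {B B' D D' n n' : ℕ} {e e' : E} (h : Rep x B D n e) (h' : Rep x B' D' n' e') :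
    Rep x (D * B * B') (D + D') (n * n') (e * e') := by
  induction h with
  | nil => simpa using Rep.zero (x := x) _ _
  | cons ha _ ih =>
    rename_i D a m e h
    have := ((h'.smul_le ha).monoD (show D' ≤ D + 1 + D' by omega)).add
      (ih.shift.monoD (show D + D' + 1 ≤ D + 1 + D' by omega))
    convert this using 1
    · ring
    · ring
    · ring

theorem force_eq {β : Type*} (n : ℕ) (f : ℕ → β) : force n f = f n := by cases n <;> rfl

theorem cast_mod (h : (251 : E) = 0) (n : ℕ) : ((n % 251 : ℕ) : E) = n := by
  conv_rhs => rw [← Nat.mod_add_div n 251]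
  push_cast [h]; ring

theorem Rep.norm (h251 : (251 : E) = 0) {B D n : ℕ} {e : E} (h : Rep x B D n e) (hB : B < bb) :
    Rep x 255 D (norm D n) e := by
  induction D generalizing n e with
  | zero => cases h; exact .nil
  | succ D ih =>
    obtain ⟨f, h1, h2, -⟩ := h.peel hB
    rw [Sept.norm, force_eq, h1, ← cast_mod h251]
    exact .cons (by omega) (ih h2)

theorem Rep.split {B k D n : ℕ} {e : E} (h : Rep x B (k + D) n e) (hB : B < bb) :
    ∃ e1 e2, e = e1 + x ^ k * e2 ∧ Rep x B k (n % bb ^ k) e1 ∧ Rep x B D (n / bb ^ k) e2 := by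
  induction k generalizing n e with
  | zero => exact ⟨0, e, by simp, by simpa [Nat.mod_one] using Rep.nil, by simpa using h⟩
  | succ k ih =>
    rw [show k + 1 + D = (k + D) + 1 by ring] at h
    obtain ⟨f, h1, h2, h3⟩ := h.peel hB
    obtain ⟨e1, e2, h4, h5, h6⟩ := ih h2
    refine ⟨((n % bb : ℕ) : E) + x * e1, e2, ?_, ?_, ?_⟩
    rotate_left
    · rw [pow_succ', Nat.mod_mul]
      exact .cons h3 h5
    · rw [pow_succ', ← Nat.div_div_eq_div_mul]
      exact h6
    · rw [h1, h4, pow_succ']; ring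

def TOK (x : E) : E → List ℕ → Prop
  | _, [] => True
  | y, r :: rs => Rep x 255 44 r y ∧ TOK x (x * y) rs

theorem hi_rep (h251 : (251 : E) = 0) {B : ℕ} (hB : B < bb) (T : List ℕ) : ∀ {A h acc : ℕ} {y e e0 : E},
    Rep x B T.length h e → TOK x y T → Rep x A 44 acc e0 →
    Rep x (A + T.length * 65025) 44 (hi T h acc) (e0 + y * e) := by
  induction T with
  | nil => intro A h acc y e e0 hr _ ha; cases hr; simpa [hi] using ha
  | cons r rs ih =>
    intro A h acc y e e0 hr ht ha
    obtain ⟨f, h1, h2, -⟩ := hr.peel hB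
    rw [hi, force_eq, force_eq]
    have h3 := ha.add (ht.1.smul_le (show h % bb % 251 ≤ 255 by omega))
    have h4 := (ih h2 ht.2 h3).mono (B' := A + (r :: rs).length * 65025) (by simp; omega)
    rw [cast_mod h251] at h4
    convert h4 using 1
    rw [h1]; ring

theorem red_rep (h251 : (251 : E) = 0) {T : List ℕ} (hT : TOK x (x ^ 44) T) (hl : T.length = 44) {B n : ℕ} {e : E}
    (hB : B ≤ 1000000000000) (h : Rep x B 88 n e) : Rep x 255 44 (red T n) e := by
  have hB' : B < bb := by rw [bb]; omega
  obtain ⟨e1, e2, h4, h5, h6⟩ := Rep.split (k := 44) (D := 44) h hB'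
  rw [red, force_eq, h4]
  refine Rep.norm h251 (hi_rep h251 hB' T (by rw [hl]; exact h6) hT h5) ?_
  rw [hl, bb]; omega

def tblG (r0 : ℕ) : ℕ → ℕ → List ℕ
  | 0, _ => []
  | j + 1, r => r :: tblG r0 j (norm 44 ((r * bb) % bb44 + (r / bb43) * r0))

theorem tblK_eq {β : Type*} (r0 : ℕ) : ∀ (j r : ℕ) (k : List ℕ → β), tblK r0 j r k = k (tblG r0 j r)
  | 0, _, _ => rfl
  | j + 1, r, k => by rw [tblK, force_eq, tblK_eq r0 j, tblG]

theorem tblG_len (r0 : ℕ) : ∀ j r, (tblG r0 j r).length = j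
  | 0, _ => rfl
  | j + 1, r => by rw [tblG, List.length_cons, tblG_len r0 j]

theorem tblG_ok (h251 : (251 : E) = 0) {r0 : ℕ} (h0 : Rep x 255 44 r0 (x ^ 44)) :
    ∀ (j : ℕ) {r : ℕ} {y : E}, Rep x 255 44 r y → TOK x y (tblG r0 j r)
  | 0, _, _, _ => trivial
  | j + 1, r, y, h => by
    refine ⟨h, tblG_ok h251 h0 j ?_⟩
    obtain ⟨e1, e2, h4, h5, h6⟩ := Rep.split (k := 43) (D := 1) h (by decide)
    obtain ⟨h9, h7⟩ := h6.digit
    have h10 := h5.shift.add (h0.smul_le h9)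
    refine Rep.norm (B := 255 + 255 * 255) h251 ?_ (by decide)
    convert h10 using 1
    · congr 1
      rw [bb44, show bb ^ 44 = bb ^ 43 * bb from pow_succ _ _, Nat.mul_mod_mul_right, mul_comm]
    · rw [h4, h7]; ring

noncomputable def evP {K : Type*} [CommRing K] : ℕ → ℕ → Polynomial K
  | 0, _ => 0
  | k + 1, n => Polynomial.C ((n % 256 : ℕ) : K) + Polynomial.X * evP k (n / 256)

theorem up_rep {K : Type*} [CommRing K] [Algebra K E] : ∀ k n, Rep x 255 k (up k n) (Polynomial.aeval x (evP (K := K) k n))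
  | 0, _ => by simpa [evP, up] using Rep.nil
  | k + 1, n => by
    have := Rep.cons (a := n % 256) (B := 255) (by omega) (up_rep (K := K) k (n / 256))
    rw [up, force_eq, evP]
    simpa using this

end rep
theorem chkA_ok : chkA = true := by decide +kernel
theorem chkB1 : chkB 1 = true := by decide +kernel
theorem chkB2 : chkB 2 = true := by decide +kernel
theorem chkB3 : chkB 3 = true := by decide +kernel
theorem chkB4 : chkB 4 = true := by decide +kernel

end Sept


namespace Sept

theorem fL_eq {β : Type*} : ∀ (L : List (ℕ × ℕ)) (k : List (ℕ × ℕ) → β), fL L k = k L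
  | [], _ => rfl
  | x :: xs, k => by rw [fL, force_eq, force_eq, fL_eq xs]

theorem fN_eq {β : Type*} : ∀ (L : List ℕ) (k : List ℕ → β), fN L k = k L
  | [], _ => rfl
  | x :: xs, k => by rw [fN, force_eq, fN_eq xs]

theorem runK_eq {β : Type*} (T : List ℕ) : ∀ (is : List (ℕ × ℕ × ℕ)) (st : List (List (ℕ × ℕ)))
    (k : List (List (ℕ × ℕ)) → β), runK T is st k = k (run (opsN T) is st)
  | [], _, _ => rfl
  | i :: is, st, k => by rw [runK, fL_eq, runK_eq T is, run]

def TT44 : List ℕ := tblG (up 44 mmD) 44 (up 44 mmD)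

theorem withT_eq {β : Type*} (k : List ℕ → β) : withT k = k TT44 := by
  rw [withT, force_eq, tblK_eq, TT44]

def stN (l : ℕ) : List (List (ℕ × ℕ)) := run (opsN TT44) instrs [baseN xD (uD.getD l [])]

theorem chkA_st : chkTh 0 (stN 0) = true ∧ chkEta TT44 (stN 0) ceD etaE = true ∧ chkEta TT44 (stN 0) coD etaO = true := by
  have h := chkA_ok
  rw [chkA, withT_eq, fL_eq, runK_eq, ← stN, Bool.and_eq_true, Bool.and_eq_true] at h
  exact h

theorem chkB_st {l : ℕ} (h : chkB l = true) : chkTh l (stN l) = true := by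
  rw [chkB, withT_eq, fL_eq, runK_eq, ← stN] at h
  exact h

theorem chkTh_all (l : Fin 5) : chkTh l (stN l) = true := by
  fin_cases l
  · exact chkA_st.1
  · exact chkB_st chkB1
  · exact chkB_st chkB2
  · exact chkB_st chkB3
  · exact chkB_st chkB4

section relp
variable {E : Type*} [CommRing E] (x : E)

def rr (l : Fin 5) (a : ℕ × ℕ) (P : MvPolynomial (Fin 5) E) : Prop :=
  Rep x 255 44 a.1 (constantCoeff P) ∧ Rep x 255 44 a.2 (constantCoeff (pderiv l P))

variable {x}

theorem cast_w (h251 : (251 : E) = 0) (a b : ℕ) : (((a + 250 * b) % 251 : ℕ) : E) = (a : E) - b := by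
  rw [cast_mod h251]; push_cast
  have : (250 : E) = 251 - 1 := by norm_num
  rw [this, h251]; ring

theorem lin_cons {R : Type*} [CommRing R] (v : (ℕ × ℕ) × R × R) (L) :
    (ringOps R).lin (v :: L) = ((v.1.1 : R) - (v.1.2 : R)) * v.2.1 * v.2.2 + (ringOps R).lin L := by
  simp [ringOps]

theorem sum1_rep (h251 : (251 : E) = 0) (l : Fin 5) {L L'} (h : List.Forall₂ (rel3 (rr x l)) L L') :
    Rep x (L.length * (251 * (44 * 255 * 255))) 88 (sum1 L) (constantCoeff ((ringOps _).lin L')) := by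
  induction h with
  | nil => simpa [sum1, ringOps] using Rep.zero (x := x) _ _
  | cons h _ ih =>
    rename_i u v L L' _
    obtain ⟨h1, h2, h3⟩ := h
    have := ((h2.1.mul h3.1).smul_le (show (u.1.1 + 250 * u.1.2) % 251 ≤ 251 by omega)).add ih
    rw [cast_w h251] at this
    convert this using 1
    · simp only [List.length_cons]; ring
    · rfl
    · simp only [lin_cons, map_add, map_mul, map_sub, map_natCast, h1]; ring

theorem sum2_rep (h251 : (251 : E) = 0) (l : Fin 5) {L L'} (h : List.Forall₂ (rel3 (rr x l)) L L') :
    Rep x (L.length * (251 * (44 * 255 * 255 + 44 * 255 * 255))) 88 (sum2 L)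
      (constantCoeff (pderiv l ((ringOps _).lin L'))) := by
  induction h with
  | nil => simpa [sum2, ringOps] using Rep.zero (x := x) _ _
  | cons h _ ih =>
    rename_i u v L L' _
    obtain ⟨h1, h2, h3⟩ := h
    have := (((h2.1.mul h3.2).add (h2.2.mul h3.1)).smul_le (show (u.1.1 + 250 * u.1.2) % 251 ≤ 251 by omega)).add ih
    rw [cast_w h251] at this
    convert this using 1
    · simp only [List.length_cons]; ring
    · rfl
    · have hc : ∀ n : ℕ, pderiv l ((n : ℕ) : MvPolynomial (Fin 5) E) = 0 := fun n => by
        simp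
      simp only [lin_cons, map_add, map_mul, map_sub, map_natCast, h1,
        Derivation.leibniz, smul_eq_mul, hc]
      simp only [map_sub, map_natCast, sub_zero, mul_zero, add_zero, map_zero, zero_sub]
      ring

theorem lin_rep (h251 : (251 : E) = 0) {T : List ℕ} (hT : TOK x (x ^ 44) T) (hl : T.length = 44) (l : Fin 5) (L L')
    (h16 : L.length ≤ 16) (h : List.Forall₂ (rel3 (rr x l)) L L') :
    rr x l ((opsN T).lin L) ((ringOps _).lin L') := by
  refine ⟨red_rep h251 hT hl ?_ (sum1_rep h251 l h), red_rep h251 hT hl ?_ (sum2_rep h251 l h)⟩ <;> omega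

variable (x)
/-- the point with values in `E` and five tangent directions -/
noncomputable def pt (K : Type*) [CommRing K] [Algebra K E] (i : Fin 8) : MvPolynomial (Fin 5) E :=
  C (Polynomial.aeval x (evP (K := K) 44 (xD.getD i 0))) +
    ∑ m : Fin 5, C (Polynomial.aeval x (evP (K := K) 44 ((uD.getD m []).getD i 0))) * X m
variable {x}

theorem base_rep (K : Type*) [CommRing K] [Algebra K E] (h251 : (251 : E) = 0) (l : Fin 5) :
    List.Forall₂ (rr x l) (baseN xD (uD.getD l [])) (base (pt x K)) := by
  have e : base (pt x K) = (List.finRange 8).map fun i : Fin 8 => ((Nat.choose 7 i : ℕ) : MvPolynomial (Fin 5) E) * pt x K i := by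
    rw [base, List.ofFn_eq_map]
  have e2 : baseN xD (uD.getD l []) = (List.finRange 8).map fun i : Fin 8 =>
      (norm 44 (Nat.choose 7 i * up 44 (xD.getD i 0)), norm 44 (Nat.choose 7 i * up 44 ((uD.getD l []).getD i 0))) := by
    rw [baseN, ← List.map_coe_finRange_eq_range, List.map_map]; rfl
  rw [e, e2]
  refine map_rel _ _ (fun i => ?_) _
  have hc : Nat.choose 7 i ≤ 35 := by revert i; decide
  have h0 : constantCoeff (pt x K i) = Polynomial.aeval x (evP (K := K) 44 (xD.getD i 0)) := by
    simp [pt]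
  have h1 : constantCoeff (pderiv l (pt x K i)) = Polynomial.aeval x (evP (K := K) 44 ((uD.getD l []).getD i 0)) := by
    simp [pt, Derivation.leibniz, pderiv_X, Pi.single_apply, Finset.sum_ite_eq]
  constructor
  · rw [map_mul, map_natCast, h0]
    exact Rep.norm h251 ((up_rep 44 _).smul_le hc) (by decide)
  · have hc' : pderiv l ((Nat.choose 7 i : ℕ) : MvPolynomial (Fin 5) E) = 0 := by simp
    rw [Derivation.leibniz, hc', smul_zero, add_zero, smul_eq_mul, map_mul, map_natCast, h1]
    exact Rep.norm h251 ((up_rep 44 _).smul_le hc) (by decide)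

theorem gen_rep (K : Type*) [CommRing K] [Algebra K E] (h251 : (251 : E) = 0)
    (hT : TOK x (x ^ 44) TT44) (l : Fin 5) (j : Fin 30) :
    rr x l (genN (stN l) j) (gen (pt x K) j) := by
  have hz : rr x l (0, 0) 0 := ⟨by simpa using Rep.zero _ _, by simpa using Rep.zero _ _⟩
  have h := run_rel (opsN TT44) (ringOps _) (ρ := rr x l) hz
    (fun L L' h16 h => lin_rep h251 hT (tblG_len _ _ _) l L L' h16 h) instrs (.cons (base_rep K h251 l) .nil)
  exact getD_rel hz (getD_rel .nil h (29 - j)) 0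

theorem Rep.const {n : ℕ} {e : E} (h : Rep x 255 44 n e) (hn : n ≤ 255) : e = n := by
  have h2 := Rep.cons (B := 255) (x := x) hn (Rep.zero (x := x) 255 43)
  simp only [mul_zero, add_zero] at h2
  exact h.uniq h2 (by decide) (by decide)

def thF : Fin 5 → Fin 30 := ![0, 1, 8, 9, 25]

theorem th_rep (K : Type*) [CommRing K] [Algebra K E] (h251 : (251 : E) = 0)
    (hT : TOK x (x ^ 44) TT44) (l m : Fin 5) :
    constantCoeff (gen (pt x K) (thF m)) = ((cD.getD m 0 : ℕ) : E) ∧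
    constantCoeff (pderiv l (gen (pt x K) (thF m))) = if m = l then 1 else 0 := by
  have h := chkTh_all l
  rw [chkTh, List.all_eq_true] at h
  have h2 := h m (by simp)
  have e : ∀ m : Fin 5, thN.getD m 0 = thF m := by decide
  have e2 : ∀ m : Fin 5, cD.getD m 0 ≤ 255 := by decide
  simp only [Bool.and_eq_true, beq_iff_eq, e] at h2
  obtain ⟨h3, h4⟩ := gen_rep K h251 hT l (thF m)
  rw [h2.1] at h3
  rw [h2.2] at h4
  refine ⟨h3.const (e2 m), ?_⟩
  rw [h4.const (by split_ifs <;> omega)]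
  simp only [Fin.ext_iff]
  split_ifs <;> simp

theorem prod_rep (K : Type*) [CommRing K] [Algebra K E] (h251 : (251 : E) = 0)
    (hT : TOK x (x ^ 44) TT44) : ∀ (L : List (Fin 30)),
    Rep x 255 44 (prodN TT44 (stN 0) L) (constantCoeff (L.map (gen (pt x K))).prod)
  | [] => by simpa [prodN] using (Rep.one (x := x) 44 (by omega)).mono (by omega)
  | a :: L => by
    rw [prodN, List.map_cons, List.prod_cons, map_mul]
    exact red_rep h251 hT (tblG_len _ _ _) (by omega) ((gen_rep K h251 hT 0 a).1.mul (prod_rep K h251 hT L))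

def dotE : ℕ → List E → E
  | _, [] => 0
  | r, a :: l => ((r % 256 : ℕ) : E) * a + dotE (r / 256) l

theorem dot_rep {L L'} (h : List.Forall₂ (Rep x 255 44) L L') : ∀ r,
    Rep x (L.length * 65025) 44 (dot r L) (dotE r L') := by
  induction h with
  | nil => intro r; simpa [dot, dotE] using Rep.zero (x := x) 0 44
  | cons h _ ih =>
    intro r
    rw [dot, force_eq, dotE]
    exact ((h.smul_le (show r % 256 ≤ 255 by omega)).add (ih _)).mono (by simp; omega)

theorem eta_rep (K : Type*) [CommRing K] [Algebra K E] (h251 : (251 : E) = 0)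
    (hT : TOK x (x ^ 44) TT44) {rows et} (he : et.length = 44) (h : chkEta TT44 (stN 0) rows et = true)
    (j : ℕ) (hj : j < 44) :
    dotE (rows.getD j 0) (et.map fun L => constantCoeff (L.map (gen (pt x K))).prod) = x ^ j := by
  rw [chkEta, fN_eq, List.all_eq_true] at h
  have h2 := h j (by simpa using hj)
  rw [beq_iff_eq] at h2
  have h3 := dot_rep (map_rel (prodN TT44 (stN 0)) (fun L => constantCoeff (L.map (gen (pt x K))).prod)
    (prod_rep K h251 hT) et) (rows.getD j 0)
  have h4 := Rep.norm h251 h3 (by rw [List.length_map, he]; decide)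
  rw [h2] at h4
  exact h4.uniq (Rep.pow j 44 hj) (by decide) (by decide)

theorem dotE_mem (K : Type*) [CommRing K] [Algebra K E] (S : Submodule K E) : ∀ (L : List E) (r : ℕ),
    (∀ a ∈ L, a ∈ S) → dotE r L ∈ S
  | [], _, _ => S.zero_mem
  | a :: L, r, h => by
    rw [dotE]
    refine S.add_mem ?_ (dotE_mem K S L _ fun b hb => h b (by simp [hb]))
    rw [← nsmul_eq_mul]
    exact S.smul_of_tower_mem _ (h a (by simp))

end relp
end Sept


namespace Sept

theorem evP_deg {K : Type*} [CommRing K] : ∀ k n, (evP (K := K) k n).degree < (k : WithBot ℕ)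
  | 0, n => by simp [evP, WithBot.bot_lt_coe]
  | k + 1, n => by
    rw [evP]
    have h := evP_deg (K := K) k (n / 256)
    refine lt_of_le_of_lt (Polynomial.degree_add_le _ _) (max_lt ?_ ?_)
    · exact lt_of_le_of_lt Polynomial.degree_C_le (by exact_mod_cast Nat.succ_pos k)
    · refine lt_of_le_of_lt (Polynomial.degree_mul_le _ _) ?_
      by_cases h0 : evP (K := K) k (n / 256) = 0
      · rw [h0, Polynomial.degree_zero, WithBot.add_bot]; exact WithBot.bot_lt_coe _
      · rw [Polynomial.degree_eq_natDegree h0] at h ⊢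
        have h1 : (evP (K := K) k (n / 256)).natDegree < k := by exact_mod_cast h
        refine lt_of_le_of_lt (add_le_add_left Polynomial.degree_X_le _) ?_
        have : 1 + (evP (K := K) k (n / 256)).natDegree < k + 1 := by omega
        exact_mod_cast this

instance fact251 : Fact (Nat.Prime 251) := ⟨by norm_num⟩

abbrev KK := ZMod 251
noncomputable def gpol : Polynomial KK := Polynomial.X ^ 44 - evP 44 mmD
noncomputable abbrev EE := AdjoinRoot gpol
noncomputable def xx : EE := AdjoinRoot.root gpol

theorem pol_aux (q : Polynomial KK) (n : ℕ) (h : q.degree < (n : WithBot ℕ)) :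
    (Polynomial.X ^ n - q).Monic ∧ (Polynomial.X ^ n - q).natDegree = n := by
  have h0 : (Polynomial.X ^ n : Polynomial KK).degree = n := Polynomial.degree_X_pow n
  refine ⟨(Polynomial.monic_X_pow n).sub_of_left (by rw [h0]; exact h), ?_⟩
  apply Polynomial.natDegree_eq_of_degree_eq_some
  rw [Polynomial.degree_sub_eq_left_of_degree_lt (by rw [h0]; exact h), h0]

theorem gpol_monic : gpol.Monic := (pol_aux _ _ (evP_deg 44 mmD)).1
theorem gpol_deg : gpol.natDegree = 44 := (pol_aux _ _ (evP_deg 44 mmD)).2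

theorem pol_aux2 (q g : Polynomial KK) (n : ℕ) (h : Polynomial.X ^ n - q = g) :
    (AdjoinRoot.root g) ^ n = Polynomial.aeval (AdjoinRoot.root g) q := by
  have h1 : Polynomial.aeval (AdjoinRoot.root g) g = 0 := by
    rw [AdjoinRoot.aeval_eq, AdjoinRoot.mk_self]
  have h2 := congrArg (Polynomial.aeval (AdjoinRoot.root g)) h
  rw [h1, map_sub, map_pow, Polynomial.aeval_X, sub_eq_zero] at h2
  exact h2

theorem h251 : (251 : EE) = 0 := by
  have : ((251 : ℕ) : EE) = algebraMap KK EE ((251 : ℕ) : KK) := (map_natCast _ _).symm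
  have h2 : ((251 : ℕ) : KK) = 0 := ZMod.natCast_self 251
  rw [h2, map_zero] at this
  exact_mod_cast this

theorem xx44 : xx ^ 44 = Polynomial.aeval xx (evP (K := KK) 44 mmD) := pol_aux2 _ _ 44 rfl

theorem hT : TOK xx (xx ^ 44) TT44 := by
  have h := up_rep (x := xx) (K := KK) 44 mmD
  rw [← xx44] at h
  exact tblG_ok h251 h 44 h

theorem span_top (S : Submodule KK EE) (h : ∀ j < 44, xx ^ j ∈ S) : S = ⊤ := by
  rw [eq_top_iff, ← (AdjoinRoot.powerBasis' gpol_monic).basis.span_eq, Submodule.span_le]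
  rintro _ ⟨i, rfl⟩
  rw [PowerBasis.basis_eq_pow, AdjoinRoot.powerBasis'_gen]
  refine h _ (lt_of_lt_of_eq i.2 ?_)
  rw [AdjoinRoot.powerBasis'_dim, gpol_deg]

theorem finrank_EE : Module.finrank KK EE = 44 := by
  rw [(AdjoinRoot.powerBasis' gpol_monic).finrank, AdjoinRoot.powerBasis'_dim, gpol_deg]

noncomputable def phi : MvPolynomial (Fin 8) KK →ₐ[KK] MvPolynomial (Fin 5) EE := aeval (pt xx KK)

theorem phi_gen (j : Fin 30) : phi (gen X j) = gen (pt xx KK) j := by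
  have := gen_map phi.toRingHom X j
  simp only [phi, AlgHom.toRingHom_eq_coe, RingHom.coe_coe, aeval_X] at this ⊢
  exact this

section fam
variable (R : Type*) [CommRing R]
noncomputable def th (m : Fin 5) : MvPolynomial (Fin 8) R := gen X (thF m)
noncomputable def et (b : Fin 2) (i : Fin 44) : MvPolynomial (Fin 8) R := ((etaL (b, i)).map (gen X)).prod
noncomputable def Gfam (b : Fin 2) (p : Fin 44 × (Fin 5 →₀ ℕ)) : MvPolynomial (Fin 8) R :=
  (p.2.prod fun m e => th R m ^ e) * et R b p.1
end fam

theorem et_indep (b : Fin 2) : LinearIndependent KK fun i => constantCoeff (phi (et KK b i)) := by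
  have key : ∀ (L : List (List (Fin 30))) (rows : List ℕ), L.length = 44 → chkEta TT44 (stN 0) rows L = true →
      LinearIndependent KK fun i : Fin 44 => constantCoeff (phi (((L.getD i []).map (gen X)).prod)) := by
    intro L rows hL hc
    refine linearIndependent_of_top_le_span_of_card_eq_finrank (le_of_eq (span_top _ fun j hj => ?_).symm) ?_
    · rw [← eta_rep (x := xx) KK h251 hT hL hc j hj]
      refine dotE_mem KK _ _ _ fun a ha => ?_
      rw [List.mem_map] at ha
      obtain ⟨m, hm, rfl⟩ := ha
      obtain ⟨i, hi, rfl⟩ := List.getElem_of_mem hm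
      refine Submodule.subset_span ⟨⟨i, by omega⟩, ?_⟩
      simp only [List.getD_eq_getElem L [] hi]
      rw [map_list_prod, List.map_map]
      congr 2
      refine List.map_congr_left fun j _ => ?_
      exact phi_gen j
    · rw [finrank_EE, Fintype.card_fin]
  fin_cases b
  · exact key etaE ceD etaE_len chkA_st.2.1
  · exact key etaO coD etaO_len chkA_st.2.2

theorem mod_indep (b : Fin 2) (a : Fin 44 → MvPolynomial (Fin 5) KK)
    (hs : ∑ i, aeval (th KK) (a i) * et KK b i = 0) (i) : a i = 0 := by
  refine main_indep phi (th KK) (et KK b) (fun m => ((cD.getD m 0 : ℕ) : KK)) (fun m => ?_) (fun m l => ?_)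
    (et_indep b) a hs i
  · rw [th, phi_gen, (th_rep KK h251 hT 0 m).1, map_natCast]
  · rw [th, phi_gen, (th_rep KK h251 hT l m).2]

theorem Gfam_indep_mod (b : Fin 2) (s : Finset (Fin 44 × (Fin 5 →₀ ℕ))) (g : Fin 44 × (Fin 5 →₀ ℕ) → KK)
    (h : ∑ p ∈ s, C (g p) * Gfam KK b p = 0) : ∀ p ∈ s, g p = 0 := by
  let a : Fin 44 → MvPolynomial (Fin 5) KK := fun i => ∑ p ∈ s with p.1 = i, monomial p.2 (g p)
  have ha := mod_indep b a (by
    rw [← h, ← Finset.sum_fiberwise s (fun p => p.1)]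
    refine Finset.sum_congr rfl fun i _ => ?_
    rw [map_sum, Finset.sum_mul]
    refine Finset.sum_congr rfl fun p hp => ?_
    rw [Finset.mem_filter] at hp
    rw [aeval_monomial, Gfam, hp.2, mul_assoc]; rfl)
  intro p hp
  have h2 := congrArg (coeff p.2) (ha p.1)
  simp only [a, coeff_sum, coeff_monomial, coeff_zero] at h2
  rw [Finset.sum_eq_single p] at h2
  · simpa using h2
  · intro q hq hne
    rw [Finset.mem_filter] at hq
    rw [if_neg fun e => hne (Prod.ext hq.2 e)]
  · intro hn; exact absurd (by rw [Finset.mem_filter]; exact ⟨hp, rfl⟩) hn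

theorem Gfam_map {R R' : Type*} [CommRing R] [CommRing R'] (f : R →+* R') (b : Fin 2) (p) :
    MvPolynomial.map f (Gfam R b p) = Gfam R' b p := by
  have h : ∀ j, MvPolynomial.map f (gen (X : Fin 8 → MvPolynomial (Fin 8) R) j) = gen X j := fun j => by
    rw [gen_map (MvPolynomial.map f)]; simp only [map_X]
  rw [Gfam, Gfam, map_mul, et, et, map_list_prod, List.map_map, Finsupp.prod, Finsupp.prod, map_prod]
  congr 1
  · refine Finset.prod_congr rfl fun m _ => ?_
    rw [map_pow, th, th, h]
  · exact congrArg _ (List.map_congr_left fun j _ => h j)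

theorem Gfam_indep_Z (b : Fin 2) (s : Finset (Fin 44 × (Fin 5 →₀ ℕ))) (g : Fin 44 × (Fin 5 →₀ ℕ) → ℤ)
    (h : ∑ p ∈ s, C (g p) * Gfam ℤ b p = 0) : ∀ p ∈ s, g p = 0 := by
  have key : ∀ k : ℕ, ∀ g : Fin 44 × (Fin 5 →₀ ℕ) → ℤ, ∑ p ∈ s, C (g p) * Gfam ℤ b p = 0 →
      ∀ p ∈ s, (251 : ℤ) ^ k ∣ g p := by
    intro k
    induction k with
    | zero => intro g _ p _; simp
    | succ k ih =>
      intro g hg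
      have h1 := congrArg (MvPolynomial.map (Int.castRingHom KK)) hg
      rw [map_sum, map_zero] at h1
      simp only [map_mul, Gfam_map, map_C] at h1
      have h2 := Gfam_indep_mod b s _ h1
      have h3 : ∀ p ∈ s, (251 : ℤ) ∣ g p := fun p hp => by
        have := h2 p hp
        rw [eq_intCast, ZMod.intCast_zmod_eq_zero_iff_dvd] at this
        exact_mod_cast this
      have h4 := ih (fun p => g p / 251) (by
        have : (C (251 : ℤ) : MvPolynomial (Fin 8) ℤ) * ∑ p ∈ s, C (g p / 251) * Gfam ℤ b p = 0 := by
          rw [← hg, Finset.mul_sum]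
          refine Finset.sum_congr rfl fun p hp => ?_
          rw [← mul_assoc, ← C_mul, Int.mul_ediv_cancel' (h3 p hp)]
        rcases mul_eq_zero.mp this with h | h
        · rw [C_eq_zero] at h; norm_num at h
        · exact h)
      intro p hp
      rw [pow_succ', ← Int.mul_ediv_cancel' (h3 p hp)]
      exact mul_dvd_mul_left _ (h4 p hp)
  intro p hp
  have h5 := key (g p).natAbs g h p hp
  refine Int.eq_zero_of_abs_lt_dvd h5 ?_
  rw [Int.abs_eq_natAbs]
  have := Nat.lt_pow_self (n := (g p).natAbs) (show 1 < 251 by norm_num)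
  exact_mod_cast this

theorem Gfam_indep_C (b : Fin 2) (s : Finset (Fin 44 × (Fin 5 →₀ ℕ))) (g : Fin 44 × (Fin 5 →₀ ℕ) → ℂ)
    (h : ∑ p ∈ s, C (g p) * Gfam ℂ b p = 0) : ∀ p ∈ s, g p = 0 := by
  classical
  let N : Submodule ℤ ℂ := Submodule.span ℤ (s.image g : Set ℂ)
  have : Module.Finite ℤ N := Module.Finite.span_of_finite ℤ (Finset.finite_toSet _)
  let B := Module.Free.chooseBasis ℤ N
  let c : Fin 44 × (Fin 5 →₀ ℕ) → N := fun p => if hp : p ∈ s then ⟨g p, Submodule.subset_span (by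
    rw [Finset.mem_coe, Finset.mem_image]; exact ⟨p, hp, rfl⟩)⟩ else 0
  have hc : ∀ p ∈ s, (c p : ℂ) = g p := fun p hp => by simp [c, hp]
  have h1 : ∀ μ, ∑ p ∈ s, coeff μ (Gfam ℤ b p) • c p = 0 := by
    intro μ
    apply Subtype.ext
    have := congrArg (coeff μ) h
    rw [coeff_sum, coeff_zero] at this
    rw [Submodule.coe_sum, Submodule.coe_zero, ← this]
    refine Finset.sum_congr rfl fun p hp => ?_
    rw [Submodule.coe_smul, hc p hp, coeff_C_mul, ← Gfam_map (Int.castRingHom ℂ), coeff_map, zsmul_eq_mul, mul_comm]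
    rfl
  have h2 : ∀ k, ∀ p ∈ s, B.coord k (c p) = 0 := by
    intro k
    refine Gfam_indep_Z b s _ ?_
    ext μ
    have := congrArg (B.coord k) (h1 μ)
    rw [map_sum, map_zero] at this
    rw [coeff_sum, coeff_zero, ← this]
    refine Finset.sum_congr rfl fun p _ => ?_
    rw [coeff_C_mul, map_smul, smul_eq_mul, mul_comm]
  intro p hp
  have h3 : c p = 0 := B.ext_elem fun k => by
    have := h2 k p hp
    rw [Module.Basis.coord_apply] at this
    rw [this]; simp
  rw [← hc p hp, h3]; rfl

end Sept


namespace Sept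

theorem NN_iff {d : ℕ} {p : RC} : p.IsHomogeneous d ↔ NN p = (d : ℂ) • p := by
  have hN : ∀ l : Fin 8 →₀ ℕ, (∑ i, (1 : ℂ) * (l i : ℂ)) = ((l.degree : ℕ) : ℂ) := by
    intro l; simp [Finsupp.degree_eq_sum]
  constructor
  · intro h
    ext l
    rw [NN, coeff_Dg, hN, coeff_smul, smul_eq_mul]
    by_cases h0 : coeff l p = 0
    · simp [h0]
    · have := h h0
      rw [← this, Finsupp.degree_eq_weight_one]; rfl
  · intro h l hl
    have h2 := congrArg (coeff l) h
    rw [NN, coeff_Dg, hN, coeff_smul, smul_eq_mul] at h2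
    have h3 := mul_right_cancel₀ hl h2
    have h4 : l.degree = d := by exact_mod_cast h3
    rw [← h4, Finsupp.degree_eq_weight_one]; rfl

theorem comp_D (D : Derivation ℂ RC RC) (hD : ∀ p, NN (D p) = D (NN p)) {f : RC} (hf : D f = 0) (j : ℕ) :
    D (homogeneousComponent j f) = 0 := by
  have hh : ∀ i, (D (homogeneousComponent i f)).IsHomogeneous i := fun i => by
    rw [NN_iff, hD, NN_iff.1 (homogeneousComponent_isHomogeneous i f), Derivation.map_smul]
  have h1 : ∑ i ∈ range (f.totalDegree + 1), D (homogeneousComponent i f) = 0 := by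
    rw [← map_sum, sum_homogeneousComponent, hf]
  by_cases hj : j ∈ range (f.totalDegree + 1)
  · have h2 := congrArg (homogeneousComponent j) h1
    rw [map_sum, map_zero, Finset.sum_eq_single j] at h2
    · rw [homogeneousComponent_of_mem (hh j)] at h2
      simpa using h2
    · intro i _ hij
      rw [homogeneousComponent_of_mem (hh i), if_neg (Ne.symm hij)]
    · intro h; exact absurd hj h
  · rw [homogeneousComponent_eq_zero, map_zero]
    rw [Finset.mem_range] at hj; omega

theorem Inv_mul {a b : ℕ} {p q : RC} (hp : p ∈ Inv a) (hq : q ∈ Inv b) : p * q ∈ Inv (a + b) := by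
  rw [mem_Inv] at *
  refine ⟨hp.1.mul hq.1, ?_, ?_⟩
  · rw [Derivation.leibniz, hp.2.1, hq.2.1]; simp
  · rw [Derivation.leibniz, hp.2.2, hq.2.2]; simp

theorem Inv_one : (1 : RC) ∈ Inv 0 := by
  rw [mem_Inv]; exact ⟨isHomogeneous_one _ _, by simp, by simp⟩

theorem Inv_pow {a : ℕ} {p : RC} (hp : p ∈ Inv a) (k : ℕ) : p ^ k ∈ Inv (a * k) := by
  induction k with
  | zero => simpa using Inv_one
  | succ k ih => rw [pow_succ, Nat.mul_succ]; exact Inv_mul ih hp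

theorem Inv_prod {s : Finset (Fin 5)} {d : Fin 5 → ℕ} {p : Fin 5 → RC} (hp : ∀ m, p m ∈ Inv (d m)) :
    ∏ m ∈ s, p m ∈ Inv (∑ m ∈ s, d m) := by
  induction s using Finset.induction_on with
  | empty => simpa using Inv_one
  | insert a s ha ih => rw [Finset.prod_insert ha, Finset.sum_insert ha]; exact Inv_mul (hp a) ih

theorem Inv_list : ∀ L : List (Fin 30), (L.map (gen (X : Fin 8 → RC))).prod ∈ Inv (mDeg L)
  | [] => by simpa [mDeg] using Inv_one
  | a :: L => by
    have := Inv_mul (gen_cov a) (Inv_list L)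
    simpa [mDeg] using this

noncomputable def qt (l : Fin 5 →₀ ℕ) : Fin 5 →₀ ℕ := Finsupp.equivFunOnFinite.symm fun m => l m / td m

theorem qt_apply (l : Fin 5 →₀ ℕ) (m) : qt l m = l m / td m := rfl

theorem mem_JJ {d : ℕ} {q} (h : q ∈ JJ d) :
    mDeg (etaL q.1) + ∑ m, q.2 m = d ∧ ∀ m, td m ∣ q.2 m := by
  rw [JJ, Finset.mem_sigma] at h
  have h2 := h.2
  split_ifs at h2 with h3
  · rw [AA, Finset.mem_filter, mem_finsuppAntidiag] at h2
    refine ⟨?_, h2.2⟩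
    rw [h2.1.1]; omega
  · simp at h2

theorem td_eq : ∀ m, degs (thF m) = td m := by decide

theorem Gfam_Inv {d : ℕ} {q} (h : q ∈ JJ d) : Gfam ℂ q.1.1 (q.1.2, qt q.2) ∈ Inv d := by
  obtain ⟨h1, h2⟩ := mem_JJ h
  rw [← h1, add_comm, Gfam]
  refine Inv_mul ?_ (Inv_list _)
  rw [Finsupp.prod_fintype _ _ (fun i => pow_zero _)]
  refine Inv_prod fun m => ?_
  have := Inv_pow (gen_cov (thF m)) (qt q.2 m)
  rw [td_eq, qt_apply, Nat.mul_div_cancel' (h2 m)] at this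
  exact this

theorem Gfam_adj (b p) : Gfam ℂ b p ∈ Algebra.adjoin ℂ (Set.range (gen (X : Fin 8 → RC))) := by
  have hg : ∀ j, gen (X : Fin 8 → RC) j ∈ Algebra.adjoin ℂ (Set.range (gen (X : Fin 8 → RC))) :=
    fun j => Algebra.subset_adjoin ⟨j, rfl⟩
  rw [Gfam]
  refine mul_mem (prod_mem fun m _ => pow_mem (hg _) _) (list_prod_mem fun a ha => ?_)
  rw [List.mem_map] at ha
  obtain ⟨j, -, rfl⟩ := ha
  exact hg j

theorem par : ∀ x : Fin 2 × Fin 44, mDeg (etaL x) % 4 = 2 * x.1 := by decide +kernel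

theorem par_JJ {d : ℕ} {q} (h : q ∈ JJ d) : d % 4 = 2 * (q.1.1 : ℕ) := by
  obtain ⟨h1, h2⟩ := mem_JJ h
  have h3 := par q.1
  have h4 : ∀ m, 4 ∣ td m := by decide
  have h5 : 4 ∣ ∑ m, q.2 m := Finset.dvd_sum fun m _ => (h4 m).trans (h2 m)
  omega

theorem Gfam_LI (b : Fin 2) : LinearIndependent ℂ (Gfam ℂ b) := by
  rw [linearIndependent_iff']
  intro s g h
  refine Gfam_indep_C b s g ?_
  rw [← h]
  exact Finset.sum_congr rfl fun p _ => (smul_eq_C_mul _ _).symm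

theorem JJ_LI (d : ℕ) : LinearIndependent ℂ fun q : JJ d => (⟨_, Gfam_Inv q.2⟩ : Inv d) := by
  refine LinearIndependent.of_comp (Inv d).subtype ?_
  rcases isEmpty_or_nonempty (JJ d) with he | ⟨⟨q0⟩⟩
  · exact linearIndependent_empty_type
  have hb : ∀ q : JJ d, q.1.1.1 = q0.1.1.1 := fun q => by
    have h1 := par_JJ q.2
    have h2 := par_JJ q0.2
    apply Fin.ext; omega
  have h := (Gfam_LI q0.1.1.1).comp (fun q : JJ d => (q.1.1.2, qt q.1.2)) (by
    intro q q' hq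
    rw [Prod.mk.injEq] at hq
    obtain ⟨⟨⟨b, i⟩, l⟩, hm⟩ := q
    obtain ⟨⟨⟨b', i'⟩, l'⟩, hm'⟩ := q'
    have e1 := (hb ⟨⟨⟨b, i⟩, l⟩, hm⟩).trans (hb ⟨⟨⟨b', i'⟩, l'⟩, hm'⟩).symm
    have e2 : l = l' := by
      ext m
      have h1 := (mem_JJ hm).2 m
      have h2 := (mem_JJ hm').2 m
      have h3 := DFunLike.congr_fun hq.2 m
      simp only [qt_apply] at h3
      simp only at h1 h2
      rw [← Nat.mul_div_cancel' h1, ← Nat.mul_div_cancel' h2, h3]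
    simp only at e1 hq
    obtain ⟨e3, -⟩ := hq
    subst e1 e2 e3
    rfl)
  convert h using 1
  funext q
  show Gfam ℂ q.1.1.1 (q.1.1.2, qt q.1.2) = Gfam ℂ q0.1.1.1 (q.1.1.2, qt q.1.2)
  rw [hb q]

theorem Inv_adj {d : ℕ} {f : RC} (hf : f ∈ Inv d) :
    f ∈ Algebra.adjoin ℂ (Set.range (gen (X : Fin 8 → RC))) := by
  have hli := JJ_LI d
  have h1 := hli.fintype_card_le_finrank
  have h2 := finrank_Inv d
  have h3 := card_JJ d
  have h4 : Fintype.card (JJ d) = Module.finrank ℂ (Inv d) := by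
    rw [Fintype.card_coe] at *
    omega
  have h5 := hli.span_eq_top_of_card_eq_finrank' h4
  have h6 : (⟨f, hf⟩ : Inv d) ∈ Submodule.span ℂ (Set.range fun q : JJ d => (⟨_, Gfam_Inv q.2⟩ : Inv d)) := by
    rw [h5]; trivial
  have h7 : Submodule.span ℂ (Set.range fun q : JJ d => (⟨_, Gfam_Inv q.2⟩ : Inv d)) ≤
      (Subalgebra.toSubmodule (Algebra.adjoin ℂ (Set.range (gen (X : Fin 8 → RC))))).comap (Inv d).subtype := by
    rw [Submodule.span_le]
    rintro _ ⟨q, rfl⟩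
    exact Gfam_adj _ _
  exact h7 h6

theorem final : ∃ p : Fin 30 → MvPolynomial (Fin 8) ℂ,
      (∀ j, (p j).IsHomogeneous (degs j)) ∧
      (∀ j, D1 (p j) = 0 ∧ D2 (p j) = 0) ∧
      (∀ f : MvPolynomial (Fin 8) ℂ, D1 f = 0 → D2 f = 0 →
        f ∈ Algebra.adjoin ℂ (Set.range p)) := by
  refine ⟨gen X, fun j => (mem_Inv.1 (gen_cov j)).1, fun j => (mem_Inv.1 (gen_cov j)).2, fun f h1 h2 => ?_⟩
  rw [← sum_homogeneousComponent f]
  refine sum_mem fun i _ => Inv_adj (d := i) ?_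
  rw [mem_Inv]
  exact ⟨homogeneousComponent_isHomogeneous i f, comp_D D1 lieND1 h1 i, comp_D D2 lieND2 h2 i⟩

end Sept


/-- **Main theorem: a complete system of 30 invariants of the binary septimic.**
There are 30 homogeneous invariants of the prescribed degrees generating the algebra
`I₇ = {f : D1 f = 0 ∧ D2 f = 0}` as a `ℂ`-algebra. -/
theorem complete_system_of_invariants :
    ∃ p : Fin 30 → MvPolynomial (Fin 8) ℂ,
      (∀ j, (p j).IsHomogeneous (degs j)) ∧
      (∀ j, D1 (p j) = 0 ∧ D2 (p j) = 0) ∧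
      (∀ f : MvPolynomial (Fin 8) ℂ, D1 f = 0 → D2 f = 0 →
        f ∈ Algebra.adjoin ℂ (Set.range p)) := Sept.final
end
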